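/- arXiv:2108.06724 — 2 statements merged into one kernel-verified Lean document; each statement's English description precedes it below -/
import Mathlib

section
/- Let f : G → G be a graph map and ⟨x,y⟩ ∈ G×G with x ≠ y. Then the following are equivalent: (1) ⟨x,y⟩ is an NS-pair for f; (2) ⟨x,y⟩ is an NS-pair for f^k for some k ∈ ℕ; (3) ⟨x,y⟩ is an NS-pair for f^k for all k ∈ ℕ. -/
open Set Filter Topology

/-- An arc in `X` with endpoints `a` and `b`: the image of a continuous injection
of `[0,1]` sending `0` to `a` and `1` to `b`. -/
def IsArcWithEnds {X : Type*} [TopologicalSpace X] (A : Set X) (a b : X) : Prop :=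
  ∃ φ : Set.Icc (0:ℝ) 1 → X, Continuous φ ∧ Function.Injective φ ∧
    Set.range φ = A ∧ φ ⟨0, by norm_num⟩ = a ∧ φ ⟨1, by norm_num⟩ = b

/-- A topological graph: a compact connected (metrizable) space which is a union of
finitely many arcs, any two of which are either disjoint or intersect in exactly one
common endpoint. -/
def IsTopGraph (X : Type*) [TopologicalSpace X] : Prop :=
  CompactSpace X ∧ ConnectedSpace X ∧
  ∃ (n : ℕ) (A : Fin n → Set X) (a b : Fin n → X),
    (∀ i, IsArcWithEnds (A i) (a i) (b i)) ∧
    (⋃ i, A i) = Set.univ ∧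
    ∀ i j, i ≠ j →
      A i ∩ A j = ∅ ∨
      ∃ p, A i ∩ A j = {p} ∧ p ∈ ({a i, b i} : Set X) ∧ p ∈ ({a j, b j} : Set X)

/-- A subgraph of `G`: a closed connected subset which is itself a topological graph. -/
def IsSubgraph {G : Type*} [TopologicalSpace G] (K : Set G) : Prop :=
  IsClosed K ∧ IsConnected K ∧ IsTopGraph ↥K

/-- A periodic subgraph with period `k`: `K, f(K), …, f^{k−1}(K)` are pairwise disjoint
and `f^k(K) = K`. -/
def IsPeriodicSubgraph {G : Type*} [TopologicalSpace G] (f : G → G) (K : Set G) (k : ℕ) :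
    Prop :=
  IsSubgraph K ∧ 0 < k ∧ f^[k] '' K = K ∧
    ∀ i j, i < k → j < k → i ≠ j → Disjoint (f^[i] '' K) (f^[j] '' K)

/-- A cycle of graphs with period `k`: the orbit `⋃_{i<k} f^i(K)` of a periodic
subgraph `K` with period `k`. -/
def IsCycleOfGraphs {G : Type*} [TopologicalSpace G] (f : G → G) (X : Set G) (k : ℕ) :
    Prop :=
  ∃ K, IsPeriodicSubgraph f K k ∧ X = ⋃ i ∈ Finset.range k, f^[i] '' K

/-- The ω-limit set of `x` under `f`. -/
def omegaSet {G : Type*} [TopologicalSpace G] (f : G → G) (x : G) : Set G :=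
  ⋂ n : ℕ, closure ((fun m => f^[m] x) '' Set.Ici n)

/-- `ω(f) = ⋃_{x} ω_f(x)`. -/
def omegaUnion {G : Type*} [TopologicalSpace G] (f : G → G) : Set G :=
  ⋃ x, omegaSet f x

/-- A set `W` is a solenoid for `f` if it is infinite and is contained in cycles of
graphs of arbitrarily large periods. -/
def IsSolenoid {G : Type*} [TopologicalSpace G] (f : G → G) (W : Set G) : Prop :=
  W.Infinite ∧ ∀ n : ℕ, ∃ X k, n ≤ k ∧ IsCycleOfGraphs f X k ∧ W ⊆ X

/-- Two points are separable if they belong to two disjoint periodic subgraphs. -/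
def SeparablePoints {G : Type*} [TopologicalSpace G] (f : G → G) (x y : G) : Prop :=
  ∃ I J kI kJ, IsPeriodicSubgraph f I kI ∧ IsPeriodicSubgraph f J kJ ∧
    Disjoint I J ∧ x ∈ I ∧ y ∈ J

/-- An NS-pair: a pair of distinct points of `ω(f)` contained in a nested sequence of
periodic subgraphs whose periods tend to infinity. -/
def IsNSPair {G : Type*} [TopologicalSpace G] (f : G → G) (x y : G) : Prop :=
  x ≠ y ∧ x ∈ omegaUnion f ∧ y ∈ omegaUnion f ∧
  ∃ (J : ℕ → Set G) (m : ℕ → ℕ),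
    (∀ n, IsPeriodicSubgraph f (J n) (m n)) ∧
    (∀ n, J (n + 1) ⊆ J n) ∧
    Filter.Tendsto m Filter.atTop Filter.atTop ∧
    ∀ n, x ∈ J n ∧ y ∈ J n

/-- The pair `⟨x,y⟩` is proximal. -/
def Proximal {G : Type*} [PseudoMetricSpace G] (f : G → G) (x y : G) : Prop :=
  ∀ ε > (0 : ℝ), ∀ N : ℕ, ∃ n ≥ N, dist (f^[n] x) (f^[n] y) < ε

/-- The pair `⟨x,y⟩` is asymptotic. -/
def Asymptotic {G : Type*} [PseudoMetricSpace G] (f : G → G) (x y : G) : Prop :=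
  Filter.Tendsto (fun n => dist (f^[n] x) (f^[n] y)) Filter.atTop (nhds 0)

/-- A scrambled pair is proximal but not asymptotic. -/
def ScrambledPair {G : Type*} [PseudoMetricSpace G] (f : G → G) (x y : G) : Prop :=
  Proximal f x y ∧ ¬ Asymptotic f x y

/-- Li–Yorke chaos: existence of an uncountable scrambled set. -/
def LiYorkeChaotic {G : Type*} [PseudoMetricSpace G] (f : G → G) : Prop :=
  ∃ S : Set G, ¬ S.Countable ∧ ∀ x ∈ S, ∀ y ∈ S, x ≠ y → ScrambledPair f x y

/-- `I ⊆ ℕ` is an independence set for the pair of sets `{A, B}`. -/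
def IsIndepSet {G : Type*} (f : G → G) (A B : Set G) (I : Set ℕ) : Prop :=
  ∀ J : Finset ℕ, ↑J ⊆ I → J.Nonempty → ∀ S : ℕ → Bool,
    (⋂ i ∈ J, f^[i] ⁻¹' (if S i then A else B)).Nonempty

/-- An IN-pair: every pair of neighborhoods has arbitrarily large finite
independence sets. -/
def IsINPair {G : Type*} [TopologicalSpace G] (f : G → G) (x y : G) : Prop :=
  ∀ U V : Set G, U ∈ nhds x → V ∈ nhds y →
    ∀ n : ℕ, ∃ I : Finset ℕ, n ≤ I.card ∧ IsIndepSet f U V ↑I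

/-- An IT-pair: every pair of neighborhoods has an infinite independence set. -/
def IsITPair {G : Type*} [TopologicalSpace G] (f : G → G) (x y : G) : Prop :=
  ∀ U V : Set G, U ∈ nhds x → V ∈ nhds y →
    ∃ I : Set ℕ, I.Infinite ∧ IsIndepSet f U V I

/-- The set of periodic points of `f`. -/
def PerPts {G : Type*} (f : G → G) : Set G :=
  {p | ∃ n ≥ 1, f^[n] p = p}

/-- A finite family of injectively parametrized edges covering `X`, any two of which meet in at
most one point, that point being an endpoint of each. -/
structure IsEdgeSystem {X ι : Type*} [TopologicalSpace X] (φ : ι → unitInterval → X) : Prop where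
  continuous : ∀ i, Continuous (φ i)
  injective : ∀ i, Function.Injective (φ i)
  exists_eq : ∀ z, ∃ i u, φ i u = z
  endpoint : ∀ i j, i ≠ j → ∀ u v, φ i u = φ j v → u = 0 ∨ u = 1
  subsingleton : ∀ i j, i ≠ j → (range (φ i) ∩ range (φ j)).Subsingleton

theorem IsTopGraph.exists_isEdgeSystem {X : Type*} [TopologicalSpace X] (h : IsTopGraph X) :
    ∃ (n : ℕ) (φ : Fin n → unitInterval → X), IsEdgeSystem φ := by
  obtain ⟨-, -, n, A, a, b, harc, hcov, hint⟩ := h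
  choose φ hc hi hr h0 h1 using harc
  refine ⟨n, φ, hc, hi, fun z => ?_, fun i j hij u v huv => ?_, fun i j hij => ?_⟩
  · obtain ⟨i, hz⟩ := mem_iUnion.1 (hcov ▸ mem_univ z)
    rw [← hr i] at hz
    exact ⟨i, hz⟩
  · have hmem : φ i u ∈ A i ∩ A j := ⟨hr i ▸ ⟨u, rfl⟩, hr j ▸ ⟨v, huv.symm⟩⟩
    rcases hint i j hij with h | ⟨p, h, hp, -⟩
    · simp [h] at hmem
    · rw [h, mem_singleton_iff] at hmem
      rcases hp with hp | hp
      · exact .inl (hi i (hmem.trans (hp.trans (h0 i).symm)))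
      · exact .inr (hi i (hmem.trans (hp.trans (h1 i).symm)))
  · rw [hr, hr]
    rcases hint i j hij with h | ⟨p, h, -⟩ <;> simp [h]

theorem IsEdgeSystem.isTopGraph {X ι : Type*} [TopologicalSpace X] [CompactSpace X]
    [ConnectedSpace X] [Finite ι] {φ : ι → unitInterval → X} (h : IsEdgeSystem φ) :
    IsTopGraph X := by
  obtain ⟨n, ⟨e⟩⟩ := Finite.exists_equiv_fin ι
  refine ⟨inferInstance, inferInstance, n, fun i => range (φ (e.symm i)),
    fun i => φ (e.symm i) 0, fun i => φ (e.symm i) 1,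
    fun i => ⟨φ (e.symm i), h.continuous _, h.injective _, rfl, rfl, rfl⟩, ?_, ?_⟩
  · refine eq_univ_of_forall fun z => ?_
    obtain ⟨i, u, rfl⟩ := h.exists_eq z
    exact mem_iUnion.2 ⟨e i, by simp⟩
  · intro i j hij
    have hij' : e.symm i ≠ e.symm j := e.symm.injective.ne hij
    rcases eq_empty_or_nonempty (range (φ (e.symm i)) ∩ range (φ (e.symm j))) with h0 | ⟨p, hp⟩
    · exact .inl h0
    · refine .inr ⟨p, (h.subsingleton _ _ hij').eq_singleton_of_mem hp, ?_⟩
      obtain ⟨⟨u, hu⟩, ⟨v, hv⟩⟩ := hp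
      constructor
      · rcases h.endpoint _ _ hij' u v (hu.trans hv.symm) with rfl | rfl <;> simp [hu]
      · rcases h.endpoint _ _ hij'.symm v u (hv.trans hu.symm) with rfl | rfl <;> simp [hv]

namespace IsEdgeSystem

variable {X ι : Type*} [TopologicalSpace X] [T2Space X] [Finite ι] {φ : ι → unitInterval → X}

theorem isOpen_image_Ioo (h : IsEdgeSystem φ) (i : ι) (s t : unitInterval) :
    IsOpen (φ i '' Ioo s t) := by
  have hEq : (φ i '' Ioo s t)ᶜ = (φ i '' (Ioo s t)ᶜ) ∪ ⋃ j ∈ {j | j ≠ i}, range (φ j) := by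
    ext z
    constructor
    · intro hz
      obtain ⟨j, u, rfl⟩ := h.exists_eq z
      by_cases hj : j = i
      · subst hj
        exact .inl ⟨u, fun hu => hz ⟨u, hu, rfl⟩, rfl⟩
      · exact .inr (mem_biUnion (show j ∈ {j | j ≠ i} from hj) ⟨u, rfl⟩)
    · rintro (⟨u, hu, rfl⟩ | hz) ⟨v, hv, hvu⟩
      · exact hu (h.injective i hvu ▸ hv)
      · obtain ⟨j, hj, w, hw⟩ := mem_iUnion₂.1 hz
        rcases h.endpoint i j (Ne.symm hj) v w (hvu.trans hw.symm) with rfl | rfl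
        · exact absurd hv.1 (not_lt.2 unitInterval.nonneg')
        · exact absurd hv.2 (not_lt.2 unitInterval.le_one')
  rw [← isClosed_compl_iff, hEq]
  refine IsClosed.union ?_ ((Set.toFinite _).isClosed_biUnion fun j _ => ?_)
  · exact (isOpen_Ioo.isClosed_compl.isCompact.image (h.continuous i)).isClosed
  · exact (isCompact_range (h.continuous j)).isClosed

/-- A connected set meeting an open segment of an edge, but not its two ends, lies in it. -/
theorem subset_image_Ioo (h : IsEdgeSystem φ) {T : Set X} (hT : IsPreconnected T) {i : ι}
    {s t u : unitInterval} (hu : u ∈ Ioo s t) (hTu : φ i u ∈ T) (hs : φ i s ∉ T)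
    (ht : φ i t ∉ T) : T ⊆ φ i '' Ioo s t := by
  refine hT.subset_of_closure_inter_subset (h.isOpen_image_Ioo i s t) ⟨_, hTu, u, hu, rfl⟩ ?_
  rintro z ⟨hz, hzT⟩
  have hcl : closure (φ i '' Ioo s t) ⊆ φ i '' Icc s t :=
    closure_minimal (image_mono Ioo_subset_Icc_self)
      (isCompact_Icc.image (h.continuous i)).isClosed
  obtain ⟨v, hv, rfl⟩ := hcl hz
  refine ⟨v, ⟨lt_of_le_of_ne hv.1 ?_, lt_of_le_of_ne hv.2 ?_⟩, rfl⟩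
  · rintro rfl
    exact hs hzT
  · rintro rfl
    exact ht hzT

/-- Two disjoint closed sets of a graph are separated by a finite set of points. -/
theorem exists_finite_separating (h : IsEdgeSystem φ) {A B : Set X} (hA : IsClosed A)
    (hB : IsClosed B) (hAB : Disjoint A B) :
    ∃ F : Set X, F.Finite ∧ ∀ T : Set X, IsPreconnected T → Disjoint T F →
      (T ∩ A).Nonempty → (T ∩ B).Nonempty → False := by
  have key : ∀ i, ∃ E : Set unitInterval, E.Finite ∧ ∀ u, u ∉ E → ∃ s ∈ E, ∃ t ∈ E,
      u ∈ Ioo s t ∧ (Disjoint (φ i '' Ioo s t) A ∨ Disjoint (φ i '' Ioo s t) B) := by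
    intro i
    have hd : Disjoint (φ i ⁻¹' A) (φ i ⁻¹' B) := hAB.preimage _
    obtain ⟨δ, hδ, hdisj⟩ := hd.exists_thickenings
      (hA.preimage (h.continuous i)).isCompact (hB.preimage (h.continuous i))
    obtain ⟨N, hN⟩ := exists_nat_one_div_lt hδ
    set E : Set unitInterval := {u | ∃ j : ℕ, j ≤ N + 1 ∧ (u : ℝ) = j / (N + 1)}
    have hN0 : (0 : ℝ) < N + 1 := by positivity
    refine ⟨E, ?_, ?_⟩
    · refine Set.Finite.of_finite_image (f := ((↑) : unitInterval → ℝ))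
        (((Set.finite_Iic (N + 1)).image
        fun j : ℕ => (j : ℝ) / (N + 1)).subset ?_) Subtype.val_injective.injOn
      rintro _ ⟨u, ⟨j, hj, hu⟩, rfl⟩
      exact ⟨j, hj, hu.symm⟩
    · intro u hu
      set j := ⌊(u : ℝ) * (N + 1)⌋₊ with hj
      have hjle : (j : ℝ) ≤ u * (N + 1) :=
        Nat.floor_le (mul_nonneg u.2.1 hN0.le)
      have hjlt : (u : ℝ) * (N + 1) < j + 1 := Nat.lt_floor_add_one _
      have hne : (u : ℝ) ≠ j / (N + 1) := fun he => hu ⟨j, by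
        have : (j : ℝ) ≤ ((N + 1 : ℕ) : ℝ) := by push_cast; nlinarith [u.2.2]
        exact_mod_cast this, he⟩
      have hu1 : (u : ℝ) ≠ 1 := fun he => hu ⟨N + 1, le_rfl, by
        rw [he]; push_cast; field_simp⟩
      have hlt : (u : ℝ) < 1 := lt_of_le_of_ne u.2.2 hu1
      have hjN : j + 1 ≤ N + 1 := by
        have : (j : ℝ) < ((N + 1 : ℕ) : ℝ) := by push_cast; nlinarith
        exact_mod_cast this
      have hjN' : ((j : ℝ) + 1) ≤ N + 1 := by exact_mod_cast hjN
      have hs : (j : ℝ) / (N + 1) ∈ Icc (0 : ℝ) 1 :=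
        ⟨by positivity, by rw [div_le_one hN0]; linarith⟩
      have ht : ((j : ℝ) + 1) / (N + 1) ∈ Icc (0 : ℝ) 1 :=
        ⟨by positivity, by rw [div_le_one hN0]; linarith⟩
      refine ⟨⟨_, hs⟩, ⟨j, by omega, rfl⟩, ⟨_, ht⟩, ⟨j + 1, hjN, by push_cast; rfl⟩, ⟨?_, ?_⟩, ?_⟩
      · refine lt_of_le_of_ne ?_ fun he => hne (congrArg Subtype.val he).symm
        exact Subtype.coe_le_coe.1 ((div_le_iff₀ hN0).2 hjle)
      · exact Subtype.coe_lt_coe.1 ((lt_div_iff₀ hN0).2 hjlt)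
      · by_contra! hcon
        obtain ⟨h1, h2⟩ := hcon
        obtain ⟨_, ⟨v, hv, rfl⟩, hvA⟩ := Set.not_disjoint_iff.1 h1
        obtain ⟨_, ⟨w, hw, rfl⟩, hwB⟩ := Set.not_disjoint_iff.1 h2
        have hvw : dist v w < δ := by
          refine lt_trans ?_ hN
          have e : ((j : ℝ) + 1) / (N + 1) = j / (N + 1) + 1 / (N + 1) := by ring
          have v1 : (j : ℝ) / (N + 1) < v := hv.1
          have v2 : (v : ℝ) < ((j : ℝ) + 1) / (N + 1) := hv.2
          have w1 : (j : ℝ) / (N + 1) < w := hw.1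
          have w2 : (w : ℝ) < ((j : ℝ) + 1) / (N + 1) := hw.2
          rw [Subtype.dist_eq, Real.dist_eq, abs_lt]
          constructor <;> linarith
        exact Set.disjoint_left.1 hdisj
          (Metric.mem_thickening_iff.2 ⟨v, hvA, by rwa [dist_comm]⟩)
          (Metric.self_subset_thickening hδ _ hwB)
  choose E hEfin hE using key
  refine ⟨⋃ i, φ i '' E i, Set.finite_iUnion fun i => (hEfin i).image _, ?_⟩
  intro T hT hTF ⟨a, haT, haA⟩ ⟨b, hbT, hbB⟩
  have hmem : ∀ i, ∀ u ∈ E i, φ i u ∉ T := fun i u hu hT' =>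
    Set.disjoint_left.1 hTF hT' (mem_iUnion.2 ⟨i, u, hu, rfl⟩)
  obtain ⟨i, u, rfl⟩ := h.exists_eq a
  obtain ⟨s, hs, t, ht, hu, hd⟩ := hE i u fun hu => hmem i u hu haT
  have hsub := h.subset_image_Ioo hT hu haT (hmem i s hs) (hmem i t ht)
  rcases hd with hd | hd
  · exact Set.disjoint_left.1 hd (hsub haT) haA
  · exact Set.disjoint_left.1 hd (hsub hbT) hbB

end IsEdgeSystem

namespace IsEdgeSystem

variable {X ι : Type*} [TopologicalSpace X] [T2Space X] {φ : ι → unitInterval → X}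

/-- A nontrivial subcontinuum of an edge is a nondegenerate segment. -/
theorem exists_image_Icc (h : IsEdgeSystem φ) {i : ι} {B : Set X} (hB : IsConnected B)
    (hBc : IsClosed B) (hnt : B.Nontrivial) (hsub : B ⊆ range (φ i)) :
    ∃ s t : unitInterval, s < t ∧ φ i '' Icc s t = B := by
  have hconn : IsConnected (φ i ⁻¹' B) := by
    refine ⟨?_, hB.isPreconnected.preimage_of_isClosedMap (h.injective i)
      (h.continuous i).isClosedMap hsub⟩
    obtain ⟨z, hz⟩ := hB.nonempty
    obtain ⟨u, rfl⟩ := hsub hz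
    exact ⟨u, hz⟩
  have hcpt : IsCompact (φ i ⁻¹' B) := (hBc.preimage (h.continuous i)).isCompact
  obtain ⟨a, ha, b, hb, hab⟩ := hnt
  obtain ⟨u, rfl⟩ := hsub ha
  obtain ⟨v, rfl⟩ := hsub hb
  obtain ⟨s, hs, hsl⟩ := hcpt.exists_isLeast hconn.nonempty
  obtain ⟨t, ht, htg⟩ := hcpt.exists_isGreatest hconn.nonempty
  have hIcc : Icc s t = φ i ⁻¹' B :=
    Subset.antisymm (hconn.isPreconnected.Icc_subset hs ht) fun w hw => ⟨hsl hw, htg hw⟩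
  refine ⟨s, t, lt_of_le_of_ne (hsl ht) ?_, ?_⟩
  · rintro rfl
    have e1 : u = s := le_antisymm (htg ha) (hsl ha)
    have e2 : v = s := le_antisymm (htg hb) (hsl hb)
    exact hab (by rw [e1, e2])
  · rw [hIcc, image_preimage_eq_of_subset hsub]

variable [Finite ι]

/-- A component of the trace of a connected set on an edge is the whole set or contains an end of
the edge. -/
theorem component_eq_or_mem (h : IsEdgeSystem φ) {K : Set X} (hK : IsPreconnected K) {i : ι}
    {z : X} (hz : z ∈ K ∩ range (φ i)) :
    connectedComponentIn (K ∩ range (φ i)) z = K ∨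
      φ i 0 ∈ connectedComponentIn (K ∩ range (φ i)) z ∨
      φ i 1 ∈ connectedComponentIn (K ∩ range (φ i)) z := by
  obtain ⟨hzK, t, rfl⟩ := hz
  have hseg : ∀ S : Set unitInterval, IsPreconnected S → t ∈ S → (∀ u ∈ S, φ i u ∈ K) →
      φ i '' S ⊆ connectedComponentIn (K ∩ range (φ i)) (φ i t) := fun S hS htS hSK =>
    (hS.image _ (h.continuous i).continuousOn).subset_connectedComponentIn ⟨t, htS, rfl⟩ <| by
      rintro _ ⟨u, hu, rfl⟩
      exact ⟨hSK u hu, u, rfl⟩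
  by_cases h0 : ∀ u ∈ Iic t, φ i u ∈ K
  · exact .inr (.inl (hseg _ isPreconnected_Iic self_mem_Iic h0
      ⟨0, unitInterval.nonneg', rfl⟩))
  by_cases h1 : ∀ u ∈ Ici t, φ i u ∈ K
  · exact .inr (.inr (hseg _ isPreconnected_Ici self_mem_Ici h1
      ⟨1, unitInterval.le_one', rfl⟩))
  push Not at h0 h1
  obtain ⟨s, hst, hs⟩ := h0
  obtain ⟨r, hrt, hr⟩ := h1
  have hne : ∀ {w}, φ i w ∉ K → w ≠ t := fun hw he => hw (he ▸ hzK)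
  have hsub := h.subset_image_Ioo hK (u := t)
    ⟨lt_of_le_of_ne hst (hne hs), lt_of_le_of_ne hrt (hne hr).symm⟩ hzK hs hr
  have hKr : K ∩ range (φ i) = K :=
    inter_eq_left.2 (hsub.trans (image_subset_range _ _))
  rw [hKr]
  exact .inl (hK.connectedComponentIn hzK)

end IsEdgeSystem

theorem IsClosed.isClosed_connectedComponentIn {X : Type*} [TopologicalSpace X] {F : Set X}
    (hF : IsClosed F) (z : X) : IsClosed (connectedComponentIn F z) := by
  by_cases hz : z ∈ F
  · refine isClosed_of_closure_subset ?_
    exact isPreconnected_connectedComponentIn.closure.subset_connectedComponentIn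
      (subset_closure (mem_connectedComponentIn hz))
      (closure_minimal (connectedComponentIn_subset F z) hF)
  · rw [connectedComponentIn_eq_empty hz]
    exact isClosed_empty

/-- The affine parametrization of the segment from `s` to `t`. -/
def segmentParam (s t u : unitInterval) : unitInterval :=
  ⟨(1 - u) * s + u * t, by
    obtain ⟨s0, s1⟩ := s.2
    obtain ⟨t0, t1⟩ := t.2
    obtain ⟨u0, u1⟩ := u.2
    constructor
    · have := mul_nonneg (sub_nonneg.2 u1) s0
      positivity
    · nlinarith⟩

theorem continuous_segmentParam (s t : unitInterval) : Continuous (segmentParam s t) := by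
  unfold segmentParam
  fun_prop

theorem segmentParam_injective {s t : unitInterval} (h : s < t) :
    Function.Injective (segmentParam s t) := by
  intro u v huv
  have h' : (s : ℝ) < t := h
  have e : (1 - (u : ℝ)) * s + u * t = (1 - v) * s + v * t := congrArg Subtype.val huv
  have : ((u : ℝ) - v) * (t - s) = 0 := by linear_combination e
  rcases mul_eq_zero.1 this with h0 | h0
  · exact Subtype.ext (sub_eq_zero.1 h0)
  · linarith

theorem range_segmentParam {s t : unitInterval} (h : s < t) :
    range (segmentParam s t) = Icc s t := by
  have h' : (s : ℝ) < t := h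
  ext w
  constructor
  · rintro ⟨u, rfl⟩
    obtain ⟨u0, u1⟩ := u.2
    constructor
    · show (s : ℝ) ≤ (1 - u) * s + u * t
      nlinarith
    · show (1 - (u : ℝ)) * s + u * t ≤ t
      nlinarith
  · rintro ⟨h1, h2⟩
    have h1' : (s : ℝ) ≤ w := h1
    have h2' : (w : ℝ) ≤ t := h2
    have hpos : (0 : ℝ) < t - s := by linarith
    refine ⟨⟨(w - s) / (t - s), div_nonneg (by linarith) hpos.le,
      (div_le_one hpos).2 (by linarith)⟩, Subtype.ext ?_⟩
    show (1 - ((w : ℝ) - s) / (t - s)) * s + (w - s) / (t - s) * t = w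
    field_simp
    ring

theorem segmentParam_endpoint {s t u : unitInterval} (h : s < t)
    (hu : segmentParam s t u = 0 ∨ segmentParam s t u = 1) : u = 0 ∨ u = 1 := by
  have h' : (s : ℝ) < t := h
  obtain ⟨s0, s1⟩ := s.2
  obtain ⟨t0, t1⟩ := t.2
  obtain ⟨u0, u1⟩ := u.2
  rcases hu with hu | hu
  · have e : (1 - (u : ℝ)) * s + u * t = 0 := congrArg Subtype.val hu
    refine .inl (Subtype.ext (le_antisymm ?_ u0))
    by_contra! hc
    have hc' : (0 : ℝ) < u := hc
    have := mul_pos hc' (s0.trans_lt h')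
    nlinarith [mul_nonneg (sub_nonneg.2 u1) s0]
  · have e : (1 - (u : ℝ)) * s + u * t = 1 := congrArg Subtype.val hu
    refine .inr (Subtype.ext (le_antisymm u1 ?_))
    by_contra! hc
    have hc' : (u : ℝ) < 1 := hc
    nlinarith [mul_pos (sub_pos.2 hc') (sub_pos.2 (h'.trans_le t1)),
      mul_nonneg u0 (sub_nonneg.2 t1)]

/-- A nondegenerate subcontinuum of a graph is a graph. -/
theorem IsTopGraph.isSubgraph {X : Type*} [TopologicalSpace X] [T2Space X] (hX : IsTopGraph X)
    {K : Set X} (hKc : IsClosed K) (hK : IsConnected K) (hnt : K.Nontrivial) : IsSubgraph K := by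
  have := hX.1
  obtain ⟨n, φ, h⟩ := hX.exists_isEdgeSystem
  have : CompactSpace K := isCompact_iff_compactSpace.1 hKc.isCompact
  have : ConnectedSpace K := isConnected_iff_connectedSpace.1 hK
  have hAc : ∀ i, IsClosed (K ∩ range (φ i)) := fun i =>
    hKc.inter (isCompact_range (h.continuous i)).isClosed
  set 𝓑 : Set (Set X) := {B | B.Nontrivial ∧ ∃ i, ∃ z ∈ K ∩ range (φ i),
    B = connectedComponentIn (K ∩ range (φ i)) z}
  have hfin : 𝓑.Finite := by
    refine ((Set.finite_singleton K).union ((Set.finite_range fun i =>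
      connectedComponentIn (K ∩ range (φ i)) (φ i 0)).union (Set.finite_range fun i =>
      connectedComponentIn (K ∩ range (φ i)) (φ i 1)))).subset ?_
    rintro B ⟨-, i, z, hz, rfl⟩
    rcases h.component_eq_or_mem hK.isPreconnected hz with h1 | h1 | h1
    · exact .inl h1
    · exact .inr (.inl ⟨i, (connectedComponentIn_eq h1).symm⟩)
    · exact .inr (.inr ⟨i, (connectedComponentIn_eq h1).symm⟩)
  have : Finite 𝓑 := hfin
  have hclosed : ∀ B ∈ 𝓑, IsClosed B := by
    rintro B ⟨-, i, z, hz, rfl⟩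
    exact (hAc i).isClosed_connectedComponentIn z
  have hsubK : ∀ B ∈ 𝓑, B ⊆ K := by
    rintro B ⟨-, i, z, hz, rfl⟩
    exact (connectedComponentIn_subset _ _).trans inter_subset_left
  have hcover : ⋃₀ 𝓑 = K := by
    refine Subset.antisymm (sUnion_subset hsubK) (sdiff_eq_empty.1 ?_)
    have hdfin : (K \ ⋃₀ 𝓑).Finite := by
      refine ((Set.finite_range fun i => φ i 0).union
        (Set.finite_range fun i => φ i 1)).subset ?_
      rintro z ⟨hzK, hzW⟩
      obtain ⟨i, u, rfl⟩ := h.exists_eq z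
      have hz : φ i u ∈ K ∩ range (φ i) := ⟨hzK, u, rfl⟩
      have hsub : (connectedComponentIn (K ∩ range (φ i)) (φ i u)).Subsingleton := by
        by_contra hns
        exact hzW ⟨_, ⟨not_subsingleton_iff.1 hns, i, _, hz, rfl⟩, mem_connectedComponentIn hz⟩
      have hself := mem_connectedComponentIn hz
      rcases h.component_eq_or_mem hK.isPreconnected hz with h1 | h1 | h1
      · rw [h1] at hsub
        exact absurd hsub (not_subsingleton_iff.2 hnt)
      · exact .inl ⟨i, hsub h1 hself⟩
      · exact .inr ⟨i, hsub h1 hself⟩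
    by_contra hne
    have hWc : IsClosed (⋃₀ 𝓑) := by
      rw [sUnion_eq_biUnion]
      exact hfin.isClosed_biUnion hclosed
    rcases eq_empty_or_nonempty (⋃₀ 𝓑) with h0 | ⟨w, hw⟩
    · rw [h0, sdiff_empty] at hdfin
      exact hK.isPreconnected.infinite_of_nontrivial hnt hdfin
    · obtain ⟨v, hv⟩ := nonempty_iff_ne_empty.2 hne
      obtain ⟨p, -, hp1, hp2⟩ := isPreconnected_closed_iff.1 hK.isPreconnected _ _ hWc
        hdfin.isClosed (by rw [union_sdiff_self]; exact subset_union_right)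
        ⟨w, sUnion_subset hsubK hw, hw⟩ ⟨v, hv.1, hv⟩
      exact hp2.2 hp1
  have hparam : ∀ B : 𝓑, ∃ i, (∃ z, (B : Set X) = connectedComponentIn (K ∩ range (φ i)) z) ∧
      ∃ s t : unitInterval, s < t ∧ φ i '' Icc s t = B := by
    rintro ⟨B, hB⟩
    have hBcl := hclosed B hB
    obtain ⟨hBnt, i, z, hz, rfl⟩ := hB
    exact ⟨i, ⟨z, rfl⟩, h.exists_image_Icc (isConnected_connectedComponentIn_iff.2 hz) hBcl hBnt
      ((connectedComponentIn_subset _ _).trans inter_subset_right)⟩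
  choose e he s t hst himg using hparam
  have hmemB : ∀ (B : 𝓑) u, φ (e B) (segmentParam (s B) (t B) u) ∈ (B : Set X) := fun B u =>
    himg B ▸ mem_image_of_mem _ (range_segmentParam (hst B) ▸ mem_range_self u)
  have hedge : ∀ B B' : 𝓑, B ≠ B' → ∀ p, p ∈ (B : Set X) → p ∈ (B' : Set X) → e B ≠ e B' := by
    intro B B' hne p hp hp' hee
    obtain ⟨z, hz⟩ := he B
    obtain ⟨z', hz'⟩ := he B'
    rw [← hee] at hz'
    rw [hz] at hp
    rw [hz'] at hp'
    exact hne (Subtype.ext (by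
      rw [hz, hz', connectedComponentIn_eq hp, connectedComponentIn_eq hp']))
  have hsys : IsEdgeSystem fun (B : 𝓑) u =>
      (⟨φ (e B) (segmentParam (s B) (t B) u), hsubK B B.2 (hmemB B u)⟩ : K) := by
    refine ⟨fun B => ?_, fun B u v huv => ?_, fun z => ?_, fun B B' hne u v huv => ?_,
      fun B B' hne => ?_⟩
    · exact ((h.continuous _).comp (continuous_segmentParam _ _)).subtype_mk _
    · exact segmentParam_injective (hst B) (h.injective _ (congrArg Subtype.val huv))
    · obtain ⟨B, hB, hzB⟩ := mem_sUnion.1 (hcover.superset z.2)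
      rw [show B = ((⟨B, hB⟩ : 𝓑) : Set X) from rfl, ← himg ⟨B, hB⟩, ← range_segmentParam (hst ⟨B, hB⟩)] at hzB
      obtain ⟨_, ⟨u, rfl⟩, hu⟩ := hzB
      exact ⟨⟨B, hB⟩, u, Subtype.ext hu⟩
    · have huv' : φ (e B) (segmentParam (s B) (t B) u) = φ (e B') (segmentParam (s B') (t B') v) :=
        congrArg Subtype.val huv
      have := hedge B B' hne _ (hmemB B u) (huv'.symm ▸ hmemB B' v)
      exact segmentParam_endpoint (hst B) (h.endpoint _ _ this _ _ huv')
    · rintro _ ⟨⟨u, rfl⟩, ⟨v, hv⟩⟩ _ ⟨⟨u', rfl⟩, ⟨v', hv'⟩⟩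
      have hv1 : φ (e B') (segmentParam (s B') (t B') v) = φ (e B) (segmentParam (s B) (t B) u) :=
        congrArg Subtype.val hv
      have hv2 : φ (e B') (segmentParam (s B') (t B') v') =
          φ (e B) (segmentParam (s B) (t B) u') := congrArg Subtype.val hv'
      have := hedge B B' hne _ (hmemB B u) (hv1 ▸ hmemB B' v)
      exact Subtype.ext (h.subsingleton _ _ this ⟨⟨_, rfl⟩, ⟨_, hv1⟩⟩ ⟨⟨_, rfl⟩, ⟨_, hv2⟩⟩)
  exact ⟨hKc, hK, hsys.isTopGraph⟩

theorem omegaUnion_iterate {G : Type*} [TopologicalSpace G] (f : G → G) {k : ℕ} (hk : 0 < k) :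
    omegaUnion (f^[k]) = omegaUnion f := by
  refine Subset.antisymm (iUnion_subset fun z => ?_) (iUnion_subset fun z w hw => ?_)
  · refine subset_iUnion_of_subset z (iInter_mono fun n => closure_mono ?_)
    rintro _ ⟨m, hm, rfl⟩
    exact ⟨k * m, (mem_Ici.1 hm).trans (Nat.le_mul_of_pos_left m hk),
      congrFun (Function.iterate_mul f k m) z⟩
  · by_contra hcon
    have hcon' : ∀ i, ∃ n, w ∉ closure ((fun m => (f^[k])^[m] (f^[i] z)) '' Ici n) := by
      intro i
      by_contra! hi
      exact hcon (mem_iUnion.2 ⟨f^[i] z, mem_iInter.2 hi⟩)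
    choose N hN using hcon'
    set n := (Finset.range k).sup N
    have hsub : (fun m => f^[m] z) '' Ici (k * n) ⊆
        ⋃ i ∈ Iio k, (fun m => (f^[k])^[m] (f^[i] z)) '' Ici (N i) := by
      rintro _ ⟨j, hj, rfl⟩
      refine mem_biUnion (show j % k ∈ Iio k from Nat.mod_lt j hk) ⟨j / k, ?_, ?_⟩
      · exact (Finset.le_sup (f := N) (Finset.mem_range.2 (Nat.mod_lt j hk))).trans
          ((Nat.le_div_iff_mul_le hk).2 (by rw [mul_comm]; exact hj))
      · show (f^[k])^[j / k] (f^[j % k] z) = f^[j] z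
        rw [← Function.iterate_mul, ← Function.iterate_add_apply, Nat.div_add_mod]
    have hw' := closure_mono hsub (mem_iInter.1 hw (k * n))
    rw [(finite_Iio k).closure_biUnion] at hw'
    obtain ⟨i, -, hi⟩ := mem_iUnion₂.1 hw'
    exact hN i hi

section Images

variable {G : Type*} {f : G → G} {J J' : Set G} {p : ℕ}

theorem image_iterate_add (f : G → G) (J : Set G) (a b : ℕ) :
    f^[a + b] '' J = f^[a] '' (f^[b] '' J) := by
  rw [Function.iterate_add, image_comp]

theorem image_iterate_mul_add (h : f^[p] '' J = J) (q i : ℕ) :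
    f^[p * q + i] '' J = f^[i] '' J := by
  induction q with
  | zero => simp
  | succ q ih =>
    rw [show p * (q + 1) + i = (p * q + i) + p by ring, image_iterate_add, h, ih]

theorem image_iterate_mod (h : f^[p] '' J = J) (i : ℕ) : f^[i % p] '' J = f^[i] '' J := by
  conv_rhs => rw [← Nat.div_add_mod i p, image_iterate_mul_add h]

theorem nonempty_inter_image_iterate {i j : ℕ}
    (h : (f^[i] '' J ∩ f^[j] '' J').Nonempty) (a : ℕ) :
    (f^[a + i] '' J ∩ f^[a + j] '' J').Nonempty := by
  rw [image_iterate_add, image_iterate_add]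
  exact (h.image f^[a]).mono (image_inter_subset _ _ _)

end Images

theorem IsPeriodicSubgraph.modEq {G : Type*} [TopologicalSpace G] {f : G → G} {K : Set G}
    {m : ℕ} (h : IsPeriodicSubgraph f K m) {i j : ℕ}
    (hij : (f^[i] '' K ∩ f^[j] '' K).Nonempty) : i ≡ j [MOD m] := by
  obtain ⟨-, hm, himg, hd⟩ := h
  by_contra hne
  rw [← image_iterate_mod himg i, ← image_iterate_mod himg j] at hij
  exact not_disjoint_iff_nonempty_inter.2 hij (hd _ _ (Nat.mod_lt i hm) (Nat.mod_lt j hm) hne)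

theorem IsPeriodicSubgraph.iterate {G : Type*} [TopologicalSpace G] {f : G → G} {K : Set G}
    {m : ℕ} (h : IsPeriodicSubgraph f K m) (k : ℕ) :
    IsPeriodicSubgraph (f^[k]) K (m / m.gcd k) := by
  have hm := h.2.1
  refine ⟨h.1, Nat.div_pos (Nat.gcd_le_left k hm) (Nat.gcd_pos_of_pos_left k hm), ?_, ?_⟩
  · have e : k * (m / m.gcd k) = m * (k / m.gcd k) := by
      rw [← Nat.mul_div_assoc _ (Nat.gcd_dvd_left m k), ← Nat.mul_div_assoc _ (Nat.gcd_dvd_right m k),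
        mul_comm]
    rw [← Function.iterate_mul, e]
    simpa using image_iterate_mul_add h.2.2.1 (k / m.gcd k) 0
  · intro i j hi hj hij
    by_contra hd
    rw [not_disjoint_iff_nonempty_inter, ← Function.iterate_mul, ← Function.iterate_mul] at hd
    exact hij (((h.modEq hd).cancel_left_div_gcd hm).eq_of_lt_of_lt hi hj)

theorem IsNSPair.iterate {G : Type*} [TopologicalSpace G] {f : G → G} {x y : G}
    (h : IsNSPair f x y) {k : ℕ} (hk : 0 < k) : IsNSPair (f^[k]) x y := by
  obtain ⟨hxy, hx, hy, J, m, hJ, hnest, hm, hmem⟩ := h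
  refine ⟨hxy, (omegaUnion_iterate f hk).symm ▸ hx, (omegaUnion_iterate f hk).symm ▸ hy, J,
    fun n => m n / (m n).gcd k, fun n => (hJ n).iterate k, hnest, ?_, hmem⟩
  refine tendsto_atTop_mono (fun n => ?_) ((Nat.tendsto_div_const_atTop hk.ne').comp hm)
  exact Nat.div_le_div_left (Nat.gcd_le_right _ hk) (Nat.gcd_pos_of_pos_right _ hk)

theorem IsPeriodicSubgraph.image_iterate_mul {G : Type*} [TopologicalSpace G] {f : G → G}
    {k m : ℕ} {J : Set G} (h : IsPeriodicSubgraph (f^[k]) J m) : f^[k * m] '' J = J := by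
  rw [Function.iterate_mul]
  exact h.2.2.1

theorem IsPeriodicSubgraph.modEq_mul {G : Type*} [TopologicalSpace G] {f : G → G} {k m : ℕ}
    {J : Set G} (h : IsPeriodicSubgraph (f^[k]) J m) (hk : 0 < k) {i j : ℕ}
    (hij : i ≡ j [MOD k]) (hne : (f^[i] '' J ∩ f^[j] '' J).Nonempty) : i ≡ j [MOD k * m] := by
  obtain ⟨k, rfl⟩ : ∃ l, k = l + 1 := ⟨k - 1, by omega⟩
  have hi : k * i + i = (k + 1) * i := by ring
  obtain ⟨b, hb⟩ : k + 1 ∣ k * i + j :=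
    (Nat.modEq_zero_iff_dvd.1 <| (hij.symm.add_left (k * i)).trans <| by
      rw [hi]; exact Nat.modEq_zero_iff_dvd.2 ⟨i, rfl⟩)
  have hne' := nonempty_inter_image_iterate hne (k * i)
  rw [hi, hb, Function.iterate_mul, Function.iterate_mul] at hne'
  have := (h.modEq hne').mul_left' (k + 1)
  rw [← hi, ← hb] at this
  exact Nat.ModEq.add_left_cancel (Nat.ModEq.refl _) this

/-- Let `J₀` be periodic of period `m₀` for `f^k`. If `J ⊆ J₀` is periodic for `f^k` with a large
period, two of the iterates of `J` under `f` can only meet at times congruent modulo `m₀`. -/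
theorem IsPeriodicSubgraph.exists_forall_modEq {G : Type*} [TopologicalSpace G] [T2Space G]
    (hG : IsTopGraph G) {f : G → G} (hf : Continuous f) {k : ℕ} (hk : 0 < k) {J₀ : Set G}
    {m₀ : ℕ} (h₀ : IsPeriodicSubgraph (f^[k]) J₀ m₀) :
    ∃ N, ∀ (J : Set G) (m : ℕ), IsPeriodicSubgraph (f^[k]) J m → J ⊆ J₀ → N < m →
      ∀ i j, (f^[i] '' J ∩ f^[j] '' J).Nonempty → i ≡ j [MOD m₀] := by
  classical
  have := hG.1
  obtain ⟨n, φ, hφ⟩ := hG.exists_isEdgeSystem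
  have hcl : ∀ i, IsClosed (f^[i] '' J₀) := fun i =>
    (h₀.1.1.isCompact.image (hf.iterate i)).isClosed
  have hF : ∀ u v, ∃ F : Set G, F.Finite ∧ ∀ T : Set G, IsPreconnected T → Disjoint T F →
      (T ∩ f^[u] '' J₀).Nonempty → (T ∩ f^[v] '' J₀).Nonempty →
      (f^[u] '' J₀ ∩ f^[v] '' J₀).Nonempty := by
    intro u v
    by_cases hd : Disjoint (f^[u] '' J₀) (f^[v] '' J₀)
    · obtain ⟨F, hF, hT⟩ := hφ.exists_finite_separating (hcl u) (hcl v) hd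
      exact ⟨F, hF, fun T h1 h2 h3 h4 => (hT T h1 h2 h3 h4).elim⟩
    · exact ⟨∅, finite_empty, fun _ _ _ _ _ => not_disjoint_iff_nonempty_inter.1 hd⟩
  choose F hFfin hF using hF
  have hFin : (⋃ u ∈ Iio (k * m₀), ⋃ v ∈ Iio (k * m₀), F u v).Finite :=
    (finite_Iio _).biUnion fun u _ => (finite_Iio _).biUnion fun v _ => hFfin u v
  set E : Finset G := hFin.toFinset with hE
  have hkm₀ : 0 < k * m₀ := Nat.mul_pos hk h₀.2.1
  have hsep : ∀ u v, ∀ T : Set G, IsPreconnected T → (∀ p ∈ T, p ∉ E) →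
      (T ∩ f^[u] '' J₀).Nonempty → (T ∩ f^[v] '' J₀).Nonempty →
      (f^[u] '' J₀ ∩ f^[v] '' J₀).Nonempty := by
    intro u v T hT hTE hu hv
    rw [← image_iterate_mod h₀.image_iterate_mul u] at hu ⊢
    rw [← image_iterate_mod h₀.image_iterate_mul v] at hv ⊢
    refine hF _ _ T hT (Set.disjoint_left.2 fun p hpT hpF => hTE p hpT ?_) hu hv
    rw [hE, Set.Finite.mem_toFinset]
    exact mem_biUnion (Nat.mod_lt u hkm₀) (mem_biUnion (Nat.mod_lt v hkm₀) hpF)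
  refine ⟨(k + 1) * E.card, fun J m hJ hJJ hm i j hij => ?_⟩
  wlog hle : i ≤ j generalizing i j
  · exact (this j i (by rwa [inter_comm]) (le_of_not_ge hle)).symm
  obtain ⟨r, rfl⟩ := Nat.exists_eq_add_of_le hle
  obtain ⟨a, ha⟩ : ∃ a, ∀ l ≤ k, ∀ p ∈ E, p ∉ f^[a + i + l * r] '' J := by
    by_contra! hbad
    have hsub : Finset.range (k * m) ⊆ (Finset.range (k + 1) ×ˢ E).biUnion fun q =>
        (Finset.range (k * m)).filter fun a => q.2 ∈ f^[a + i + q.1 * r] '' J := by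
      intro a ha
      obtain ⟨l, hl, p, hp, hpa⟩ := hbad a
      exact Finset.mem_biUnion.2 ⟨(l, p), Finset.mem_product.2
        ⟨Finset.mem_range.2 (by omega), hp⟩, Finset.mem_filter.2 ⟨ha, hpa⟩⟩
    have hcard := (Finset.card_le_card hsub).trans
      (Finset.card_biUnion_le_card_mul _ _ k fun q _ => ?_)
    · rw [Finset.card_range, Finset.card_product, Finset.card_range, mul_comm _ k] at hcard
      exact absurd (Nat.le_of_mul_le_mul_left hcard hk) (not_le.2 hm)
    · refine (Finset.card_le_card_of_injOn (t := Finset.range k) (fun a => a % k)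
        (fun a _ => by simpa using Nat.mod_lt a hk) fun a ha b hb hab => ?_).trans_eq
        (Finset.card_range k)
      simp only [Finset.coe_filter, Finset.mem_range, mem_ofPred_eq] at ha hb
      have hab' : a ≡ b [MOD k] := hab
      have := hJ.modEq_mul hk ((hab'.add_right i).add_right (q.1 * r)) ⟨q.2, ha.2, hb.2⟩
      exact ((this.add_right_cancel' _).add_right_cancel' _).eq_of_lt_of_lt ha.1 hb.1
  have hconn : IsPreconnected (⋃ l ∈ Iic k, f^[a + i + l * r] '' J) := by
    refine IsPreconnected.biUnion_of_chain ordConnected_Iic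
      (fun l _ => hJ.1.2.1.isPreconnected.image _ (hf.iterate _).continuousOn) fun l _ _ => ?_
    have := nonempty_inter_image_iterate hij (a + l * r)
    rwa [show a + l * r + i = a + i + l * r by ring,
      show a + l * r + (i + r) = a + i + Order.succ l * r by rw [Order.succ_eq_add_one]; ring] at this
  obtain ⟨z, hz⟩ := hJ.1.2.1.nonempty
  have hmeet : ∀ l ≤ k, ((⋃ l ∈ Iic k, f^[a + i + l * r] '' J) ∩
      f^[a + i + l * r] '' J₀).Nonempty := fun l hl =>
    ⟨_, mem_biUnion (mem_Iic.2 hl) (mem_image_of_mem _ hz), mem_image_of_mem _ (hJJ hz)⟩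
  have hmeet' := hsep _ _ _ hconn (fun p hp hpE => by
    obtain ⟨l, hl, hpl⟩ := mem_iUnion₂.1 hp
    exact ha l hl p hpE hpl) (hmeet 0 (Nat.zero_le k)) (hmeet k le_rfl)
  have hmod := h₀.modEq_mul hk (by simp [Nat.ModEq]) hmeet'
  have hkr : 0 * r ≡ k * r [MOD k * m₀] := hmod.add_left_cancel' _
  rw [zero_mul] at hkr
  have hr : m₀ ∣ r := Nat.dvd_of_mul_dvd_mul_left hk (Nat.modEq_zero_iff_dvd.1 hkr.symm)
  simpa using (Nat.modEq_zero_iff_dvd.2 hr).symm.add_left i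

/-- The component of the full orbit of an `f^k`-periodic subgraph is `f`-periodic. -/
theorem IsPeriodicSubgraph.exists_period_component {G : Type*} [TopologicalSpace G] [T2Space G]
    (hG : IsTopGraph G) {f : G → G} (hf : Continuous f) {k m : ℕ} (hk : 0 < k) {J : Set G}
    (hJ : IsPeriodicSubgraph (f^[k]) J m) {x y : G} (hx : x ∈ J) (hy : y ∈ J) (hxy : x ≠ y) :
    ∃ d, IsPeriodicSubgraph f (connectedComponentIn (⋃ i, f^[i] '' J) x) d ∧
      ∀ M, (∀ i j, (f^[i] '' J ∩ f^[j] '' J).Nonempty → i ≡ j [MOD M]) → M ∣ d := by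
  have := hG.1
  obtain ⟨p, hp⟩ : ∃ p, k * m = p + 1 :=
    ⟨k * m - 1, by have := Nat.mul_pos hk hJ.2.1; omega⟩
  have hper : f^[p + 1] '' J = J := hp ▸ hJ.image_iterate_mul
  set U := ⋃ i, f^[i] '' J with hU
  set C : ℕ → Set G := fun i => connectedComponentIn U (f^[i] x) with hC
  have hScl : ∀ i, IsClosed (f^[i] '' J) := fun i =>
    (hJ.1.1.isCompact.image (hf.iterate i)).isClosed
  have hxS : ∀ i, f^[i] x ∈ f^[i] '' J := fun i => mem_image_of_mem _ hx
  have hSU : ∀ i, f^[i] '' J ⊆ U := fun i => subset_iUnion (fun i => f^[i] '' J) i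
  have hSC : ∀ i, f^[i] '' J ⊆ C i := fun i =>
    (hJ.1.2.1.isPreconnected.image _ (hf.iterate i).continuousOn).subset_connectedComponentIn
      (hxS i) (hSU i)
  have hUmod : U = ⋃ i ∈ Iio (p + 1), f^[i] '' J := by
    refine Subset.antisymm (iUnion_subset fun i => ?_) (iUnion₂_subset fun i _ => hSU i)
    rw [← image_iterate_mod hper i]
    exact subset_biUnion_of_mem (u := fun i => f^[i] '' J)
      (show i % (p + 1) ∈ Iio (p + 1) from Nat.mod_lt i p.succ_pos)
  have hUcl : IsClosed U := hUmod ▸ (finite_Iio _).isClosed_biUnion fun i _ => hScl i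
  have hCeq : ∀ i j z, z ∈ C i → z ∈ C j → C i = C j := fun i j z hi hj =>
    (connectedComponentIn_eq hi).trans (connectedComponentIn_eq hj).symm
  have hCper : ∀ q i, C ((p + 1) * q + i) = C i := fun q i =>
    hCeq _ _ _ (hSC _ (hxS _)) (hSC i (image_iterate_mul_add hper q i ▸ hxS _))
  have hCsub : ∀ a i, f^[a] '' C i ⊆ C (a + i) := by
    intro a i
    refine (isPreconnected_connectedComponentIn.image _
      (hf.iterate a).continuousOn).subset_connectedComponentIn ?_ ?_
    · rw [Function.iterate_add_apply]
      exact mem_image_of_mem _ (hSC i (hxS i))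
    · refine (image_mono (connectedComponentIn_subset _ _)).trans ?_
      rw [hU, image_iUnion]
      refine iUnion_subset fun j => ?_
      rw [← image_iterate_add]
      exact hSU _
  have hCfix : ∀ q i, C i ⊆ f^[(p + 1) * q] '' C i := by
    intro q i z hz
    obtain ⟨j, hj⟩ := mem_iUnion.1 (connectedComponentIn_subset _ _ hz)
    have hji : C j = C i := hCeq _ _ z (hSC j hj) hz
    have hj' := hj
    rw [← image_iterate_mul_add hper q j, image_iterate_add] at hj'
    exact image_mono ((hSC j).trans hji.subset) hj'
  have hCimg : ∀ a i, f^[a] '' C i = C (a + i) := by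
    intro a i
    refine (hCsub a i).antisymm ((hCfix a _).trans ?_)
    rw [show (p + 1) * a = a + p * a by ring, image_iterate_add]
    refine image_mono ((hCsub _ _).trans ?_)
    rw [show p * a + (a + i) = (p + 1) * a + i by ring, hCper]
  have hex : ∃ d, 0 < d ∧ C d = C 0 := ⟨p + 1, p.succ_pos, by simpa using hCper 1 0⟩
  classical
  obtain ⟨hd, hCd⟩ := Nat.find_spec hex
  have hmin : ∀ i j, i < j → j < Nat.find hex → Disjoint (C i) (C j) := by
    intro i j hij hj
    by_contra hcon
    obtain ⟨z, hzi, hzj⟩ := not_disjoint_iff.1 hcon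
    have h1 : C (p * i + i) = C (p * i + j) := by
      rw [← hCimg, ← hCimg, hCeq i j z hzi hzj]
    rw [show p * i + i = (p + 1) * i + 0 by ring,
      show p * i + j = (p + 1) * i + (j - i) by rw [add_mul, one_mul]; omega,
      hCper, hCper] at h1
    exact Nat.find_min hex (m := j - i) (by omega) ⟨by omega, h1.symm⟩
  have hJC : J ⊆ C 0 := by simpa using hSC 0
  refine ⟨Nat.find hex, ⟨?_, hd, ?_, ?_⟩, fun M hM => ?_⟩
  · exact hG.isSubgraph (hUcl.isClosed_connectedComponentIn x)
      ⟨⟨x, hJC hx⟩, isPreconnected_connectedComponentIn⟩ ⟨x, hJC hx, y, hJC hy, hxy⟩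
  · exact (hCimg _ 0).trans hCd
  · intro i j hi hj hij
    show Disjoint (f^[i] '' C 0) (f^[j] '' C 0)
    rw [hCimg, hCimg]
    rcases lt_or_gt_of_ne hij with h | h
    · exact hmin i j h hj
    · exact (hmin j i h hi).symm
  · set A : Set ℕ := {i | M ∣ i}
    have hAcl : ∀ B : Set ℕ, IsClosed (⋃ i ∈ Iio (p + 1) ∩ B, f^[i] '' J) := fun B =>
      ((finite_Iio _).inter_of_left B).isClosed_biUnion fun i _ => hScl i
    have hcov : C 0 ⊆ (⋃ i ∈ Iio (p + 1) ∩ A, f^[i] '' J) ∪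
        ⋃ i ∈ Iio (p + 1) ∩ Aᶜ, f^[i] '' J := by
      rw [← biUnion_union, inter_union_compl, ← hUmod]
      exact connectedComponentIn_subset _ _
    have hdC : f^[Nat.find hex] x ∈ C 0 := hCd.subset (hSC _ (hxS _))
    rcases hcov hdC with hdA | hdA
    · obtain ⟨i, hi, hmem⟩ := mem_iUnion₂.1 hdA
      exact Nat.modEq_zero_iff_dvd.1
        ((hM _ _ ⟨_, hxS _, hmem⟩).trans (Nat.modEq_zero_iff_dvd.2 hi.2))
    · obtain ⟨z, -, hz1, hz2⟩ := isPreconnected_closed_iff.1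
        (isPreconnected_connectedComponentIn (F := U) (x := f^[0] x)) _ _ (hAcl A) (hAcl Aᶜ) hcov
        ⟨x, hJC hx, mem_biUnion (⟨p.succ_pos, dvd_zero M⟩ : 0 ∈ Iio (p + 1) ∩ A) (hxS 0)⟩
        ⟨_, hdC, hdA⟩
      obtain ⟨i, hi, hzi⟩ := mem_iUnion₂.1 hz1
      obtain ⟨j, hj, hzj⟩ := mem_iUnion₂.1 hz2
      exact absurd (Nat.modEq_zero_iff_dvd.1
        ((hM j i ⟨z, hzj, hzi⟩).trans (Nat.modEq_zero_iff_dvd.2 hi.2))) hj.2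

theorem IsNSPair.of_iterate {G : Type*} [TopologicalSpace G] [T2Space G] (hG : IsTopGraph G)
    {f : G → G} (hf : Continuous f) {x y : G} {k : ℕ} (hk : 0 < k)
    (h : IsNSPair (f^[k]) x y) : IsNSPair f x y := by
  obtain ⟨hxy, hx, hy, J, m, hJ, hnest, hm, hmem⟩ := h
  rw [omegaUnion_iterate f hk] at hx hy
  choose d hd hdvd using fun n =>
    (hJ n).exists_period_component hG hf hk (hmem n).1 (hmem n).2 hxy
  refine ⟨hxy, hx, hy, _, d, hd, fun n => ?_, tendsto_atTop.2 fun b => ?_, fun n => ?_⟩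
  · exact connectedComponentIn_mono x (iUnion_mono fun i => image_mono (hnest n))
  · obtain ⟨n₀, hn₀⟩ := (hm.eventually_ge_atTop b).exists
    obtain ⟨N, hN⟩ := (hJ n₀).exists_forall_modEq hG hf hk
    filter_upwards [eventually_ge_atTop n₀, hm.eventually_gt_atTop N] with n hn hNn
    exact hn₀.trans (Nat.le_of_dvd (hd n).2.1
      (hdvd n _ (hN _ _ (hJ n) (antitone_nat_of_succ_le hnest hn) hNn)))
  · have hsub : J n ⊆ connectedComponentIn (⋃ i, f^[i] '' J n) x :=
      (hJ n).1.2.1.isPreconnected.subset_connectedComponentIn (hmem n).1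
        (by simpa using subset_iUnion (fun i => f^[i] '' J n) 0)
    exact ⟨hsub (hmem n).1, hsub (hmem n).2⟩

/-- `⟨x,y⟩` is an NS-pair for `f` iff it is an NS-pair for some power `f^k` (`k ≥ 1`)
iff it is an NS-pair for every power `f^k` (`k ≥ 1`). -/
theorem nsPair_iff_pow {G : Type*} [MetricSpace G]
    (hG : IsTopGraph G) (f : G → G) (hf : Continuous f) (x y : G) (hxy : x ≠ y) :
    (IsNSPair f x y ↔ ∃ k : ℕ, 0 < k ∧ IsNSPair (f^[k]) x y) ∧
    (IsNSPair f x y ↔ ∀ k : ℕ, 0 < k → IsNSPair (f^[k]) x y) := by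
  exact ⟨⟨fun h => ⟨1, one_pos, h.iterate one_pos⟩, fun ⟨_, hk, h⟩ => h.of_iterate hG hf hk⟩,
    fun h _ hk => h.iterate hk, fun h => h 1 one_pos⟩
end

section
/- Let f : G → G be a graph map and let ⟨x,y⟩ be an NS-pair, witnessed by a sequence (J_n) of periodic subgraphs with periods (m_n) such that J_{n+1} ⊆ J_n, m_n → ∞, and x, y ∈ J_n for all n. Then for every k ∈ ℕ and every 0 ≤ i ≤ m_k − 1, there exist x* ∈ f^{−(m_k−i)}(x) ∩ f^i(J_k) and y* ∈ f^{−(m_k−i)}(y) ∩ f^i(J_k) such that ⟨x*,y*⟩ is an NS-pair for the restriction of f^{m_k} to the (f^{m_k}-invariant) subgraph f^i(J_k). -/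
open Set Filter Topology

/-- An NS-pair relative to a `g`-invariant set `X` (the NS-pair notion for the
restriction of `g` to `X`). -/
def IsNSPairOn {G : Type*} [TopologicalSpace G] (g : G → G) (X : Set G) (x y : G) :
    Prop :=
  x ≠ y ∧ (∃ z ∈ X, x ∈ omegaSet g z) ∧ (∃ z ∈ X, y ∈ omegaSet g z) ∧
  ∃ (J : ℕ → Set G) (m : ℕ → ℕ),
    (∀ n, IsPeriodicSubgraph g (J n) (m n)) ∧
    (∀ n, J n ⊆ X) ∧
    (∀ n, J (n + 1) ⊆ J n) ∧
    Filter.Tendsto m Filter.atTop Filter.atTop ∧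
    ∀ n, x ∈ J n ∧ y ∈ J n

/-- A decomposition of a space into finitely many parametrized arcs, any two of which are
disjoint or meet in exactly one common endpoint. -/
structure ArcDecomposition (G : Type*) [TopologicalSpace G] (ι : Type*) where
  /-- The parametrizations of the arcs. -/
  arc : ι → Set.Icc (0:ℝ) 1 → G
  continuous_arc : ∀ j, Continuous (arc j)
  injective_arc : ∀ j, Function.Injective (arc j)
  exists_arc_eq : ∀ p, ∃ j t, arc j t = p
  subsingleton_inter : ∀ i j, i ≠ j → (Set.range (arc i) ∩ Set.range (arc j)).Subsingleton
  eq_zero_or_one : ∀ i j, i ≠ j → ∀ s t, arc i s = arc j t → s = 0 ∨ s = 1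

/-- Every topological graph has a finite arc decomposition. -/
theorem IsTopGraph.exists_arcDecomposition {G : Type*} [TopologicalSpace G]
    (hG : IsTopGraph G) : ∃ n : ℕ, Nonempty (ArcDecomposition G (Fin n)) := by
  obtain ⟨-, -, n, A, a, b, harc, hcov, hint⟩ := hG
  choose φ hφc hφi hφA hφa hφb using harc
  refine ⟨n, ⟨⟨φ, hφc, hφi, ?_, ?_, ?_⟩⟩⟩
  · intro p
    have hp : p ∈ ⋃ i, A i := hcov ▸ mem_univ p
    obtain ⟨j, hj⟩ := mem_iUnion.1 hp
    rw [← hφA j] at hj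
    exact ⟨j, hj⟩
  · intro i j hij
    rw [hφA, hφA]
    rcases hint i j hij with h | ⟨p, h, -⟩ <;> rw [h]
    · exact subsingleton_empty
    · exact subsingleton_singleton
  · intro i j hij s t hst
    have hmem : φ i s ∈ A i ∩ A j := ⟨hφA i ▸ mem_range_self s, by
      rw [hst, ← hφA j]; exact mem_range_self t⟩
    rcases hint i j hij with h | ⟨p, h, hp, -⟩
    · rw [h] at hmem; exact hmem.elim
    · rw [h] at hmem
      rcases hp with hp | hp
      · left
        apply hφi i
        rw [mem_singleton_iff.1 hmem, hp, ← hφa i]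
        rfl
      · right
        apply hφi i
        rw [mem_singleton_iff.1 hmem, mem_singleton_iff.1 hp, ← hφb i]
        rfl

/-- A nondegenerate closed subinterval of a parametrized arc is an arc. -/
theorem isArcWithEnds_image_Icc {X : Type*} [TopologicalSpace X] {φ : Set.Icc (0:ℝ) 1 → X}
    (hc : Continuous φ) (hi : Function.Injective φ) {a b : Set.Icc (0:ℝ) 1} (hab : a < b) :
    IsArcWithEnds (φ '' Set.Icc a b) (φ a) (φ b) := by
  have hab' : (a : ℝ) < b := hab
  have hpos : (0 : ℝ) < b - a := sub_pos.2 hab'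
  have ha := a.2
  have hb := b.2
  let ψ : Set.Icc (0:ℝ) 1 → Set.Icc (0:ℝ) 1 := fun t =>
    ⟨a + t * (b - a), by
      have ht := t.2
      constructor
      · have := mul_nonneg ht.1 hpos.le
        linarith [ha.1]
      · have := mul_le_mul_of_nonneg_right ht.2 hpos.le
        linarith [hb.2]⟩
  have hψc : Continuous ψ := by fun_prop
  refine ⟨φ ∘ ψ, hc.comp hψc, hi.comp ?_, ?_, ?_, ?_⟩
  · intro s t hst
    have h : (a : ℝ) + s * (b - a) = a + t * (b - a) := congrArg Subtype.val hst
    exact Subtype.ext (mul_right_cancel₀ hpos.ne' (add_left_cancel h))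
  · rw [range_comp]
    congr 1
    ext u
    constructor
    · rintro ⟨t, rfl⟩
      have ht := t.2
      constructor
      · change (a : ℝ) ≤ a + t * (b - a)
        have := mul_nonneg ht.1 hpos.le
        linarith
      · change (a : ℝ) + t * (b - a) ≤ b
        have := mul_le_mul_of_nonneg_right ht.2 hpos.le
        linarith
    · rintro ⟨h1, h2⟩
      have h1' : (a : ℝ) ≤ u := h1
      have h2' : (u : ℝ) ≤ b := h2
      refine ⟨⟨(u - a) / (b - a), div_nonneg (sub_nonneg.2 h1') hpos.le,
        (div_le_one hpos).2 (by linarith)⟩, Subtype.ext ?_⟩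
      change (a : ℝ) + (u - a) / (b - a) * (b - a) = u
      rw [div_mul_cancel₀ _ hpos.ne']
      ring
  · change φ (ψ _) = φ a
    congr 1
    apply Subtype.ext
    change (a : ℝ) + 0 * (b - a) = a
    ring
  · change φ (ψ _) = φ b
    congr 1
    apply Subtype.ext
    change (a : ℝ) + 1 * (b - a) = b
    ring

/-- A nonempty compact preconnected subset of `[0,1]` is a closed interval. -/
theorem exists_eq_Icc_of_isPreconnected {C : Set (Set.Icc (0:ℝ) 1)} (hne : C.Nonempty)
    (hcl : IsClosed C) (hC : IsPreconnected C) : ∃ a b, a ≤ b ∧ C = Set.Icc a b := by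
  obtain ⟨a, ha⟩ := hcl.isCompact.exists_isLeast hne
  obtain ⟨b, hb⟩ := hcl.isCompact.exists_isGreatest hne
  refine ⟨a, b, ha.2 hb.1, Subset.antisymm (fun t ht => ⟨ha.2 ht, hb.2 ht⟩) ?_⟩
  exact hC.ordConnected.out ha.1 hb.1

namespace ArcDecomposition

variable {G : Type*} [TopologicalSpace G] {ι : Type*}

theorem isClosedEmbedding_arc [T2Space G] (D : ArcDecomposition G ι) (j : ι) :
    IsClosedEmbedding (D.arc j) :=
  (D.continuous_arc j).isClosedEmbedding (D.injective_arc j)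

/-- The image of an open set of parameters avoiding the endpoints is open. -/
theorem isOpen_image [T2Space G] [Finite ι] (D : ArcDecomposition G ι) (j : ι)
    {O : Set (Set.Icc (0:ℝ) 1)} (hO : IsOpen O) (h0 : 0 ∉ O) (h1 : 1 ∉ O) : IsOpen (D.arc j '' O) := by
  have hcompl : (D.arc j '' O)ᶜ =
      D.arc j '' Oᶜ ∪ ⋃ l ∈ {l | l ≠ j}, Set.range (D.arc l) := by
    ext p
    simp only [mem_compl_iff, mem_union, mem_iUnion]
    constructor
    · intro hp
      obtain ⟨l, t, rfl⟩ := D.exists_arc_eq p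
      by_cases hl : l = j
      · subst hl
        exact Or.inl ⟨t, fun ht => hp ⟨t, ht, rfl⟩, rfl⟩
      · exact Or.inr ⟨l, hl, t, rfl⟩
    · rintro (⟨t, ht, rfl⟩ | ⟨l, hl, t, rfl⟩) ⟨s, hs, hst⟩
      · exact ht (D.injective_arc j hst ▸ hs)
      · rcases D.eq_zero_or_one j l (Ne.symm hl) s t hst with rfl | rfl
        · exact h0 hs
        · exact h1 hs
  rw [← isClosed_compl_iff, hcompl]
  refine ((D.isClosedEmbedding_arc j).isClosedMap _ hO.isClosed_compl).union ?_
  exact (Set.toFinite _).isClosed_biUnion fun l _ => (D.isClosedEmbedding_arc l).isClosed_range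

/-- The components of the trace of `K` on the arcs of the decomposition. -/
def pieces (D : ArcDecomposition G ι) (K : Set G) : Set (ι × Set (Set.Icc (0:ℝ) 1)) :=
  {P | ∃ t ∈ D.arc P.1 ⁻¹' K, P.2 = connectedComponentIn (D.arc P.1 ⁻¹' K) t}

/-- If a component of the trace of a connected set `K` on an arc contains no endpoint
of the arc, then it is the whole trace. -/
theorem connectedComponentIn_eq_preimage [T2Space G] [Finite ι] (D : ArcDecomposition G ι)
    {K : Set G} (hK : IsPreconnected K) (j : ι) {t : Set.Icc (0:ℝ) 1}
    (ht : t ∈ D.arc j ⁻¹' K) (h0 : 0 ∉ connectedComponentIn (D.arc j ⁻¹' K) t)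
    (h1 : 1 ∉ connectedComponentIn (D.arc j ⁻¹' K) t) :
    connectedComponentIn (D.arc j ⁻¹' K) t = D.arc j ⁻¹' K := by
  obtain ⟨s, hst, hs⟩ : ∃ s ≤ t, s ∉ D.arc j ⁻¹' K := by
    by_contra! h
    exact h0 (isPreconnected_Icc.subset_connectedComponentIn (s := Set.Icc 0 t)
      (right_mem_Icc.2 t.2.1) (fun u hu => h u hu.2) (left_mem_Icc.2 t.2.1))
  obtain ⟨r, htr, hr⟩ : ∃ r ≥ t, r ∉ D.arc j ⁻¹' K := by
    by_contra! h
    exact h1 (isPreconnected_Icc.subset_connectedComponentIn (s := Set.Icc t 1)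
      (left_mem_Icc.2 t.2.2) (fun u hu => h u hu.1) (right_mem_Icc.2 t.2.2))
  have hst : s < t := lt_of_le_of_ne hst (by rintro rfl; exact hs ht)
  have htr : t < r := lt_of_le_of_ne htr (by rintro rfl; exact hr ht)
  have hopen : IsOpen (D.arc j '' Set.Ioo s r) := D.isOpen_image j isOpen_Ioo
    (fun h => (not_lt.2 s.2.1) h.1) (fun h => (not_lt.2 r.2.2) h.2)
  have hclosed : IsClosed (D.arc j '' Set.Icc s r) :=
    (D.isClosedEmbedding_arc j).isClosedMap _ isClosed_Icc
  have hsub : K ⊆ D.arc j '' Set.Ioo s r := by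
    refine hK.subset_left_of_subset_union hopen hclosed.isOpen_compl ?_ ?_
      ⟨D.arc j t, ht, t, ⟨hst, htr⟩, rfl⟩
    · exact disjoint_compl_right_iff_subset.2 (image_mono Ioo_subset_Icc_self)
    · intro p hp
      by_cases h : p ∈ D.arc j '' Set.Icc s r
      · obtain ⟨u, hu, rfl⟩ := h
        refine Or.inl ⟨u, ⟨lt_of_le_of_ne hu.1 ?_, lt_of_le_of_ne hu.2 ?_⟩, rfl⟩
        · rintro rfl; exact hs hp
        · rintro rfl; exact hr hp
      · exact Or.inr h
  have himg : D.arc j '' (D.arc j ⁻¹' K) = K :=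
    image_preimage_eq_of_subset (hsub.trans (image_subset_range _ _))
  have hpre : IsPreconnected (D.arc j ⁻¹' K) := by
    rw [← (D.isClosedEmbedding_arc j).isInducing.isPreconnected_image, himg]
    exact hK
  exact Subset.antisymm (connectedComponentIn_subset _ _)
    (hpre.subset_connectedComponentIn ht Subset.rfl)

theorem finite_pieces [T2Space G] [Finite ι] (D : ArcDecomposition G ι) {K : Set G}
    (hK : IsPreconnected K) : (D.pieces K).Finite := by
  refine (((Set.finite_univ (α := ι)).image
      fun j => (j, connectedComponentIn (D.arc j ⁻¹' K) 0)).union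
    (((Set.finite_univ (α := ι)).image
      fun j => (j, connectedComponentIn (D.arc j ⁻¹' K) 1)).union
    ((Set.finite_univ (α := ι)).image fun j => (j, D.arc j ⁻¹' K)))).subset ?_
  rintro ⟨j, C⟩ ⟨t, ht, hC⟩
  dsimp only at ht hC
  subst hC
  by_cases h0 : 0 ∈ connectedComponentIn (D.arc j ⁻¹' K) t
  · exact Or.inl ⟨j, mem_univ _, by rw [connectedComponentIn_eq h0]⟩
  by_cases h1 : 1 ∈ connectedComponentIn (D.arc j ⁻¹' K) t
  · exact Or.inr (Or.inl ⟨j, mem_univ _, by rw [connectedComponentIn_eq h1]⟩)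
  · exact Or.inr (Or.inr ⟨j, mem_univ _, by
      rw [D.connectedComponentIn_eq_preimage hK j ht h0 h1]⟩)

theorem exists_mem_pieces (D : ArcDecomposition G ι) {K : Set G} {p : G} (hp : p ∈ K) :
    ∃ P ∈ D.pieces K, p ∈ D.arc P.1 '' P.2 := by
  obtain ⟨j, t, rfl⟩ := D.exists_arc_eq p
  exact ⟨(j, connectedComponentIn (D.arc j ⁻¹' K) t), ⟨t, hp, rfl⟩, t,
    mem_connectedComponentIn hp, rfl⟩

theorem image_piece_subset (D : ArcDecomposition G ι) {K : Set G}
    {P : ι × Set (Set.Icc (0:ℝ) 1)} (hP : P ∈ D.pieces K) : D.arc P.1 '' P.2 ⊆ K := by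
  obtain ⟨t, ht, h⟩ := hP
  rw [h, image_subset_iff]
  exact connectedComponentIn_subset _ _

theorem exists_piece_eq_Icc [T2Space G] (D : ArcDecomposition G ι) {K : Set G} (hcl : IsClosed K)
    {P : ι × Set (Set.Icc (0:ℝ) 1)} (hP : P ∈ D.pieces K) :
    ∃ a b, a ≤ b ∧ P.2 = Set.Icc a b := by
  obtain ⟨t, ht, h⟩ := hP
  have hpre := isPreconnected_connectedComponentIn (F := D.arc P.1 ⁻¹' K) (x := t)
  have hmem := mem_connectedComponentIn ht
  have hclosure : closure (connectedComponentIn (D.arc P.1 ⁻¹' K) t) ⊆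
      connectedComponentIn (D.arc P.1 ⁻¹' K) t :=
    hpre.closure.subset_connectedComponentIn (subset_closure hmem)
      (closure_minimal (connectedComponentIn_subset _ _) (hcl.preimage (D.continuous_arc _)))
  rw [h]
  exact exists_eq_Icc_of_isPreconnected ⟨t, hmem⟩ (isClosed_of_closure_subset hclosure) hpre

theorem disjoint_of_mem_pieces (D : ArcDecomposition G ι) {K : Set G} {j : ι}
    {C C' : Set (Set.Icc (0:ℝ) 1)} (hC : (j, C) ∈ D.pieces K) (hC' : (j, C') ∈ D.pieces K)
    (hne : C ≠ C') : Disjoint C C' := by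
  obtain ⟨t, ht, hC⟩ := hC
  obtain ⟨t', ht', hC'⟩ := hC'
  dsimp only at ht hC ht' hC'
  subst hC hC'
  by_contra h
  obtain ⟨u, hu, hu'⟩ := not_disjoint_iff.1 h
  exact hne ((connectedComponentIn_eq hu).trans (connectedComponentIn_eq hu').symm)

/-- A closed connected subset of a graph has only finitely many non-interior points. -/
theorem finite_diff_interior [T2Space G] [Finite ι] (D : ArcDecomposition G ι) {K : Set G}
    (hcl : IsClosed K) (hK : IsPreconnected K) : (K \ interior K).Finite := by
  have hIcc : ∀ P ∈ D.pieces K, ∃ F : Set G, F.Finite ∧ D.arc P.1 '' P.2 ⊆ F ∪ interior K := by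
    intro P hP
    obtain ⟨a, b, hab, h⟩ := D.exists_piece_eq_Icc hcl hP
    refine ⟨{D.arc P.1 a, D.arc P.1 b}, Set.toFinite _, ?_⟩
    have hsub := D.image_piece_subset hP
    rw [h] at hsub ⊢
    rintro _ ⟨u, hu, rfl⟩
    by_cases hua : u = a
    · exact Or.inl (Or.inl (by rw [hua]))
    by_cases hub : u = b
    · exact Or.inl (Or.inr (by rw [hub]; rfl))
    refine Or.inr (interior_maximal ((image_mono Ioo_subset_Icc_self).trans hsub) ?_
      ⟨u, ⟨lt_of_le_of_ne hu.1 (Ne.symm hua), lt_of_le_of_ne hu.2 hub⟩, rfl⟩)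
    exact D.isOpen_image P.1 isOpen_Ioo
      (fun h => (not_lt.2 a.2.1) h.1) (fun h => (not_lt.2 b.2.2) h.2)
  choose! F hF hsub using hIcc
  refine ((D.finite_pieces hK).biUnion hF).subset ?_
  rintro p ⟨hpK, hpi⟩
  obtain ⟨P, hP, hp⟩ := D.exists_mem_pieces hpK
  exact mem_biUnion hP ((hsub P hP hp).resolve_right hpi)

/-- A nondegenerate closed connected set is the union of its nondegenerate pieces. -/
theorem exists_nontrivial_piece [T2Space G] [Finite ι] (D : ArcDecomposition G ι) {K : Set G}
    (hcl : IsClosed K) (hK : IsPreconnected K) (hnt : K.Nontrivial) {p : G} (hp : p ∈ K) :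
    ∃ P ∈ D.pieces K, P.2.Nontrivial ∧ p ∈ D.arc P.1 '' P.2 := by
  have hfin := D.finite_pieces hK
  let N : Set G := ⋃ P ∈ {P ∈ D.pieces K | P.2.Nontrivial}, D.arc P.1 '' P.2
  let T : Set G := ⋃ P ∈ {P ∈ D.pieces K | ¬ P.2.Nontrivial}, D.arc P.1 '' P.2
  have hN : IsClosed N := (hfin.subset (sep_subset _ _)).isClosed_biUnion fun P hP => by
    obtain ⟨a, b, -, h⟩ := D.exists_piece_eq_Icc hcl hP.1
    rw [h]
    exact (D.isClosedEmbedding_arc _).isClosedMap _ isClosed_Icc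
  have hT : T.Finite := (hfin.subset (sep_subset _ _)).biUnion fun P hP =>
    ((not_nontrivial_iff.1 hP.2).finite).image _
  have hcover : K ⊆ N ∪ (T \ N) := by
    rw [union_sdiff_self]
    intro q hq
    obtain ⟨P, hP, hqP⟩ := D.exists_mem_pieces hq
    by_cases h : P.2.Nontrivial
    · exact Or.inl (mem_biUnion (show P ∈ {P ∈ D.pieces K | P.2.Nontrivial} from ⟨hP, h⟩) hqP)
    · exact Or.inr (mem_biUnion (show P ∈ {P ∈ D.pieces K | ¬ P.2.Nontrivial} from ⟨hP, h⟩) hqP)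
  have hsub : K ⊆ N := by
    rcases isPreconnected_iff_subset_of_disjoint_closed.1 hK N (T \ N) hN
      (hT.subset sdiff_subset).isClosed hcover (by rw [inter_sdiff_self, inter_empty]) with h | h
    · exact h
    · exact ((hK.infinite_of_nontrivial hnt) (hT.subset (h.trans sdiff_subset))).elim
  obtain ⟨P, hP, hpP⟩ := mem_iUnion₂.1 (hsub hp)
  exact ⟨P, hP.1, hP.2, hpP⟩

end ArcDecomposition

/-- A nondegenerate subcontinuum of a topological graph is a topological graph. -/
theorem IsTopGraph.isTopGraph_coe {G : Type*} [TopologicalSpace G] [T2Space G]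
    (hG : IsTopGraph G) {K : Set G} (hcl : IsClosed K) (hK : IsConnected K)
    (hnt : K.Nontrivial) : IsTopGraph ↥K := by
  obtain ⟨n, ⟨D⟩⟩ := hG.exists_arcDecomposition
  have := hG.1
  refine ⟨isCompact_iff_compactSpace.1 hcl.isCompact, isConnected_iff_connectedSpace.1 hK, ?_⟩
  have hfin : {P ∈ D.pieces K | P.2.Nontrivial}.Finite :=
    (D.finite_pieces hK.isPreconnected).subset (sep_subset _ _)
  have hends : ∀ P ∈ {P ∈ D.pieces K | P.2.Nontrivial},
      ∃ a b, a < b ∧ P.2 = Set.Icc a b := by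
    rintro P ⟨hP, hPnt⟩
    obtain ⟨a, b, hab, h⟩ := D.exists_piece_eq_Icc hcl hP
    refine ⟨a, b, lt_of_le_of_ne hab ?_, h⟩
    rintro rfl
    rw [h, Set.Icc_self] at hPnt
    exact not_nontrivial_singleton hPnt
  obtain ⟨N, ⟨e⟩⟩ : ∃ N : ℕ, Nonempty (Fin N ≃ {P ∈ D.pieces K | P.2.Nontrivial}) :=
    have := hfin.to_subtype
    ⟨_, ⟨(Finite.equivFin _).symm⟩⟩
  choose a b hab hP using fun r => hends (e r) (e r).2
  have hsub : ∀ r, D.arc (e r).1.1 '' Set.Icc (a r) (b r) ⊆ K := fun r =>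
    hP r ▸ D.image_piece_subset (e r).2.1
  have hmemK : ∀ r, ∀ u ∈ Set.Icc (a r) (b r), D.arc (e r).1.1 u ∈ K := fun r u hu =>
    hsub r (mem_image_of_mem _ hu)
  have hendpt : ∀ r s, e r ≠ e s → ∀ u ∈ Set.Icc (a r) (b r), ∀ v ∈ Set.Icc (a s) (b s),
      D.arc (e r).1.1 u = D.arc (e s).1.1 v → (e r).1.1 ≠ (e s).1.1 ∧ (u = a r ∨ u = b r) := by
    intro r s hrs u hu v hv huv
    have hne : (e r).1.1 ≠ (e s).1.1 := by
      intro hj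
      have hC : ((e r).1.1, (e r).1.2) ∈ D.pieces K := (e r).2.1
      have hC' : ((e r).1.1, (e s).1.2) ∈ D.pieces K := hj ▸ (e s).2.1
      have hdis := D.disjoint_of_mem_pieces hC hC'
        (fun h => hrs (Subtype.ext (Prod.ext hj h)))
      rw [← hj] at huv
      rw [hP r, hP s] at hdis
      exact disjoint_left.1 hdis hu (D.injective_arc _ huv ▸ hv)
    refine ⟨hne, ?_⟩
    rcases D.eq_zero_or_one _ _ hne u v huv with rfl | rfl
    · exact Or.inl (le_antisymm (a r).2.1 hu.1)
    · exact Or.inr (le_antisymm hu.2 (b r).2.2)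
  refine ⟨N, fun r => Subtype.val ⁻¹' (D.arc (e r).1.1 '' Set.Icc (a r) (b r)),
    fun r => ⟨D.arc (e r).1.1 (a r), hmemK r _ (left_mem_Icc.2 (hab r).le)⟩,
    fun r => ⟨D.arc (e r).1.1 (b r), hmemK r _ (right_mem_Icc.2 (hab r).le)⟩, ?_, ?_, ?_⟩
  · intro r
    obtain ⟨ψ, hψc, hψi, hψr, hψ0, hψ1⟩ :=
      isArcWithEnds_image_Icc (D.continuous_arc (e r).1.1) (D.injective_arc _) (hab r)
    have hψK : ∀ t, ψ t ∈ K := fun t => hsub r (hψr ▸ mem_range_self t)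
    refine ⟨fun t => ⟨ψ t, hψK t⟩, by fun_prop, fun s t h => hψi (congrArg Subtype.val h),
      ?_, Subtype.ext hψ0, Subtype.ext hψ1⟩
    ext ⟨p, hp⟩
    simp [← hψr]
  · refine eq_univ_of_forall fun p => ?_
    obtain ⟨P, hPp, hPnt, hp⟩ := D.exists_nontrivial_piece hcl hK.isPreconnected hnt p.2
    refine mem_iUnion.2 ⟨e.symm ⟨P, hPp, hPnt⟩, ?_⟩
    change (p : G) ∈ D.arc _ '' _
    rw [← hP, e.apply_symm_apply]
    exact hp
  · intro r s hrs
    have hrs' : e r ≠ e s := fun h => hrs (e.injective h)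
    rw [or_iff_not_imp_left]
    intro hne
    obtain ⟨p, ⟨u, hu, hup⟩, ⟨v, hv, hvp⟩⟩ := nonempty_iff_ne_empty.2 hne
    obtain ⟨hj, hur⟩ := hendpt r s hrs' u hu v hv (hup.trans hvp.symm)
    obtain ⟨-, hvs⟩ := hendpt s r hrs'.symm v hv u hu (hvp.trans hup.symm)
    refine ⟨p, ?_, ?_, ?_⟩
    · refine Subset.antisymm ?_ (singleton_subset_iff.2 ⟨⟨u, hu, hup⟩, ⟨v, hv, hvp⟩⟩)
      rintro q ⟨⟨u', -, hu'⟩, ⟨v', -, hv'⟩⟩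
      exact Subtype.ext (D.subsingleton_inter _ _ hj ⟨⟨u', hu'⟩, ⟨v', hv'⟩⟩
        ⟨⟨u, hup⟩, ⟨v, hvp⟩⟩)
    · rcases hur with rfl | rfl
      · exact Or.inl (Subtype.ext hup.symm)
      · exact Or.inr (Subtype.ext hup.symm)
    · rcases hvs with rfl | rfl
      · exact Or.inl (Subtype.ext hvp.symm)
      · exact Or.inr (Subtype.ext hvp.symm)

namespace IsPeriodicSubgraph

variable {G : Type*} [TopologicalSpace G] {f : G → G} {K L : Set G} {p q : ℕ}

theorem image_iterate_add_mul (h : IsPeriodicSubgraph f K p) (a c : ℕ) :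
    f^[a + c * p] '' K = f^[a] '' K := by
  induction c with
  | zero => simp
  | succ c ih =>
    rw [Nat.succ_mul, ← add_assoc, Function.iterate_add, image_comp, h.2.2.1, ih]

theorem image_iterate_mod (h : IsPeriodicSubgraph f K p) (a : ℕ) :
    f^[a % p] '' K = f^[a] '' K := by
  conv_rhs => rw [← Nat.mod_add_div' a p]
  exact (h.image_iterate_add_mul _ _).symm

theorem image_iterate_congr (h : IsPeriodicSubgraph f K p) {a b : ℕ} (hab : a ≡ b [MOD p]) :
    f^[a] '' K = f^[b] '' K := by
  rw [← h.image_iterate_mod a, ← h.image_iterate_mod b, hab]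

theorem modEq_of_mem (h : IsPeriodicSubgraph f K p) {a b : ℕ} {z : G}
    (ha : z ∈ f^[a] '' K) (hb : z ∈ f^[b] '' K) : a ≡ b [MOD p] := by
  by_contra hne
  rw [← h.image_iterate_mod] at ha hb
  exact disjoint_left.1 (h.2.2.2 _ _ (Nat.mod_lt _ h.2.1) (Nat.mod_lt _ h.2.1) hne) ha hb

/-- The period of a periodic subgraph divides the periods of its periodic subgraphs. -/
theorem dvd_of_subset (h : IsPeriodicSubgraph f K p) (hL : IsPeriodicSubgraph f L q)
    (hLK : L ⊆ K) : p ∣ q := by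
  obtain ⟨z, hz⟩ := hL.1.2.1.nonempty
  refine (Nat.modEq_zero_iff_dvd).1 (h.modEq_of_mem (z := z) ?_ ?_)
  · exact image_mono hLK (hL.2.2.1.symm ▸ hz)
  · simpa using hLK hz

/-- Images of a periodic subgraph of period `q` are periodic for `f^p` when `p ∣ q`. -/
theorem image_iterate [T2Space G] (hG : IsTopGraph G) (hf : Continuous f)
    (h : IsPeriodicSubgraph f K q) (hnt : K.Nontrivial) (hpq : p ∣ q) (a : ℕ) :
    IsPeriodicSubgraph f^[p] (f^[a] '' K) (q / p) := by
  have := hG.1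
  have hq := h.2.1
  have hp : 0 < p := Nat.pos_of_dvd_of_pos hpq hq
  have hcl : IsClosed (f^[a] '' K) := (h.1.1.isCompact.image (hf.iterate a)).isClosed
  have hcon : IsConnected (f^[a] '' K) := h.1.2.1.image _ (hf.iterate a).continuousOn
  have hntimage : (f^[a] '' K).Nontrivial := by
    apply Set.nontrivial_of_image f^[a * q - a]
    rw [← image_comp, ← Function.iterate_add,
      Nat.sub_add_cancel (Nat.le_mul_of_pos_right a hq)]
    have := h.image_iterate_add_mul 0 a
    rw [zero_add] at this
    rw [this]
    simpa using hnt
  refine ⟨⟨hcl, hcon, hG.isTopGraph_coe hcl hcon hntimage⟩, Nat.div_pos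
    (Nat.le_of_dvd hq hpq) hp, ?_, ?_⟩
  · rw [← Function.iterate_mul, Nat.mul_div_cancel' hpq, ← image_comp, ← Function.iterate_add]
    exact h.image_iterate_congr (by simp [Nat.ModEq])
  · intro i j hi hj hij
    rw [← Function.iterate_mul, ← Function.iterate_mul, ← image_comp, ← image_comp,
      ← Function.iterate_add, ← Function.iterate_add, Set.disjoint_left]
    intro z hzi hzj
    have hmod := Nat.ModEq.add_right_cancel' a (h.modEq_of_mem hzi hzj)
    have hlt : ∀ l, l < q / p → p * l < q := fun l hl =>
      (Nat.lt_div_iff_mul_lt' hpq l).1 hl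
    exact hij (Nat.eq_of_mul_eq_mul_left hp (hmod.eq_of_lt_of_lt (hlt i hi) (hlt j hj)))

end IsPeriodicSubgraph

theorem exists_ultrafilter_of_mem_omegaSet {G : Type*} [TopologicalSpace G] {f : G → G}
    {x z : G} (h : x ∈ omegaSet f z) :
    ∃ U : Ultrafilter ℕ, ↑U ≤ (atTop : Filter ℕ) ∧ Tendsto (fun n => f^[n] z) U (𝓝 x) := by
  apply mapClusterPt_iff_ultrafilter.1
  refine mapClusterPt_iff_frequently.2 fun s hs => frequently_atTop.2 fun n => ?_
  obtain ⟨_, hps, l, hl, rfl⟩ := mem_closure_iff_nhds.1 (mem_iInter.1 h n) s hs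
  exact ⟨l, hl, hps⟩

section Nested

variable {G : Type*} [TopologicalSpace G] {f : G → G} {J : ℕ → Set G} {m : ℕ → ℕ}

/-- Points of a nested intersection of periodic subgraphs with unbounded periods have
infinite orbits. -/
theorem injective_iterate_of_mem_nested (hJ : ∀ n, IsPeriodicSubgraph f (J n) (m n))
    (hm : Tendsto m atTop atTop) {x : G} (hx : ∀ n, x ∈ J n) :
    Function.Injective fun s => f^[s] x := by
  intro s t hst
  obtain ⟨N, hN⟩ := (hm.eventually_gt_atTop (max s t)).exists
  have hmem : f^[s] x ∈ f^[t] '' J N := ⟨x, hx N, hst.symm⟩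
  exact ((hJ N).modEq_of_mem (mem_image_of_mem _ (hx N)) hmem).eq_of_lt_of_lt
    ((le_max_left _ _).trans_lt hN) ((le_max_right _ _).trans_lt hN)

/-- If `x ∈ ω_f(z)` lies in all subgraphs of the nested sequence, the orbit of `z` enters
each of them. -/
theorem exists_iterate_mem_of_mem_omegaSet [T2Space G] (hG : IsTopGraph G) (hf : Continuous f)
    (hJ : ∀ n, IsPeriodicSubgraph f (J n) (m n)) (hm : Tendsto m atTop atTop) {x z : G}
    (hx : ∀ n, x ∈ J n) (hz : x ∈ omegaSet f z) (n : ℕ) : ∃ t, f^[t] z ∈ J n := by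
  obtain ⟨r, ⟨D⟩⟩ := hG.exists_arcDecomposition
  have hfin := D.finite_diff_interior (hJ n).1.1 (hJ n).1.2.1.isPreconnected
  have hinj : Function.Injective fun s => f^[s * m n] x :=
    (injective_iterate_of_mem_nested hJ hm hx).comp
      (mul_left_injective₀ (hJ n).2.1.ne')
  obtain ⟨s, hs⟩ : ∃ s, f^[s * m n] x ∈ interior (J n) := by
    by_contra! h
    refine (Set.infinite_range_of_injective hinj) (hfin.subset ?_)
    rintro _ ⟨s, rfl⟩
    refine ⟨?_, h s⟩
    have := (hJ n).image_iterate_add_mul 0 s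
    simp only [zero_add, Function.iterate_zero, image_id] at this
    rw [← this]
    exact mem_image_of_mem _ (hx n)
  obtain ⟨U, -, hUx⟩ := exists_ultrafilter_of_mem_omegaSet hz
  have hev := (((hf.iterate (s * m n)).tendsto x).comp hUx).eventually
    (isOpen_interior.mem_nhds hs)
  obtain ⟨t, ht⟩ := hev.exists
  refine ⟨s * m n + t, ?_⟩
  rw [Function.iterate_add_apply]
  exact interior_subset ht

/-- If the orbit of `z` visits a periodic subgraph of period `p` at time `t` and converges to
a point of it along an ultrafilter, then along the ultrafilter all times are congruent to `t`
modulo `p`. -/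
theorem IsPeriodicSubgraph.eventually_modEq [T2Space G] [CompactSpace G] (hf : Continuous f)
    {K : Set G} {p t : ℕ} (hK : IsPeriodicSubgraph f K p) {x z : G} (hx : x ∈ K) (ht : f^[t] z ∈ K)
    {U : Ultrafilter ℕ} (hU : ↑U ≤ (atTop : Filter ℕ))
    (hUx : Tendsto (fun n => f^[n] z) U (𝓝 x)) :
    ∀ᶠ n in (U : Filter ℕ), t ≤ n ∧ n ≡ t [MOD p] := by
  let W : Set G := ⋃ j ∈ {j | j < p ∧ j ≠ 0}, f^[j] '' K
  have hW : IsClosed W :=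
    ((Set.finite_lt_nat p).subset fun j hj => hj.1).isClosed_biUnion fun j _ =>
      (hK.1.1.isCompact.image (hf.iterate j)).isClosed
  have hxW : x ∉ W := by
    intro h
    obtain ⟨j, ⟨hjp, hj0⟩, hj⟩ := mem_iUnion₂.1 h
    exact hj0 ((hK.modEq_of_mem hj (b := 0) (by simpa using hx)).eq_of_lt_of_lt hjp hK.2.1)
  filter_upwards [hUx.eventually (hW.isOpen_compl.mem_nhds hxW), hU (Ici_mem_atTop t)]
    with n hn htn
  refine ⟨htn, ?_⟩
  have hmem : f^[n] z ∈ f^[(n - t) % p] '' K := by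
    rw [hK.image_iterate_mod]
    refine ⟨f^[t] z, ht, ?_⟩
    rw [← Function.iterate_add_apply, Nat.sub_add_cancel htn]
  by_contra hne
  refine hn (mem_biUnion (show (n - t) % p ∈ {j | j < p ∧ j ≠ 0} from
    ⟨Nat.mod_lt _ hK.2.1, fun h0 => hne ?_⟩) hmem)
  exact ((Nat.modEq_iff_dvd' htn).2 (Nat.dvd_of_mod_eq_zero h0)).symm

/-- A point of `ω(f)` in a nested intersection of periodic subgraphs has a preimage of order
`d ≤ m k` which is an ω-limit point of `f^{m_k}` and lies in the corresponding preimage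
subgraphs. -/
theorem exists_preimage_mem_omegaSet [T2Space G] (hG : IsTopGraph G) (hf : Continuous f)
    (hJ : ∀ n, IsPeriodicSubgraph f (J n) (m n)) (hm : Tendsto m atTop atTop) {x : G}
    (hx : ∀ n, x ∈ J n) (hω : x ∈ omegaUnion f) {k d : ℕ} (hd : d ≤ m k) :
    ∃ x', f^[d] x' = x ∧ (∀ n, d ≤ m n → x' ∈ f^[m n - d] '' J n) ∧
      ∃ z ∈ f^[m k - d] '' J k, x' ∈ omegaSet f^[m k] z := by
  have := hG.1
  obtain ⟨z, hz⟩ := mem_iUnion.1 hω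
  choose t ht using exists_iterate_mem_of_mem_omegaSet hG hf hJ hm hx hz
  obtain ⟨U, hU, hUx⟩ := exists_ultrafilter_of_mem_omegaSet hz
  have hev := fun n => (hJ n).eventually_modEq hf (hx n) (ht n) hU hUx
  obtain ⟨x', hx'⟩ : ∃ x', Tendsto (fun n => f^[n - d] z) U (𝓝 x') := by
    obtain ⟨x', -, h⟩ := isCompact_univ.ultrafilter_le_nhds
      (U.map fun n => f^[n - d] z) (by simp)
    exact ⟨x', h⟩
  have hmem : ∀ n, d ≤ m n → ∀ᶠ s in (U : Filter ℕ), f^[s - d] z ∈ f^[m n - d] '' J n := by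
    intro n hdn
    filter_upwards [hev n, hU (Ici_mem_atTop (t n + d))] with s hs hsd
    have hsd : t n + d ≤ s := hsd
    have hcongr : s - d - t n ≡ m n - d [MOD m n] := by
      apply Nat.ModEq.add_right_cancel' (d + t n)
      rw [show s - d - t n + (d + t n) = s by omega,
        show m n - d + (d + t n) = m n + t n by omega]
      exact hs.2.trans (by simp [Nat.ModEq])
    rw [← (hJ n).image_iterate_congr hcongr]
    refine ⟨f^[t n] z, ht n, ?_⟩
    rw [← Function.iterate_add_apply]
    congr 1
    omega
  refine ⟨x', ?_, ?_, ?_⟩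
  · refine tendsto_nhds_unique (((hf.iterate d).tendsto x').comp hx') (hUx.congr' ?_)
    filter_upwards [hU (Ici_mem_atTop d)] with s hs
    have hs : d ≤ s := hs
    rw [Function.comp_apply, ← Function.iterate_add_apply, Nat.add_sub_cancel' hs]
  · intro n hdn
    exact ((hJ n).1.1.isCompact.image (hf.iterate _)).isClosed.mem_of_tendsto hx' (hmem n hdn)
  · obtain ⟨s₀, ⟨hs₀, hmod₀⟩, hs₀d, hmem₀⟩ :=
      ((hev k).and ((Filter.Eventually.filter_mono hU (eventually_ge_atTop d)).and
        (hmem k hd))).exists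
    refine ⟨_, hmem₀, mem_iInter.2 fun N => mem_closure_of_tendsto hx' ?_⟩
    filter_upwards [hev k, hU (Ici_mem_atTop (s₀ + m k * N))] with s hs hsN
    have hsN : s₀ + m k * N ≤ s := hsN
    have hle : s₀ ≤ s := le_trans (Nat.le_add_right _ _) hsN
    obtain ⟨c, hc⟩ := (Nat.modEq_iff_dvd' hle).1 (hmod₀.trans hs.2.symm)
    refine ⟨c, ?_, ?_⟩
    · have : m k * N ≤ m k * c := by omega
      exact Nat.le_of_mul_le_mul_left this (hJ k).2.1
    · change (f^[m k])^[c] (f^[s₀ - d] z) = f^[s - d] z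
      rw [← Function.iterate_mul, ← Function.iterate_add_apply]
      congr 1
      omega

end Nested

/-- Given an NS-pair `⟨x,y⟩` witnessed by periodic subgraphs `(J_n)` with periods
`(m_n)`, for every `k` and `0 ≤ i ≤ m_k − 1` there are preimages
`x* ∈ f^{−(m_k−i)}(x) ∩ f^i(J_k)` and `y* ∈ f^{−(m_k−i)}(y) ∩ f^i(J_k)` forming an
NS-pair for the restriction of `f^{m_k}` to `f^i(J_k)`. -/
theorem nsPair_preimage {G : Type*} [MetricSpace G]
    (hG : IsTopGraph G) (f : G → G) (hf : Continuous f) (x y : G) (hxy : x ≠ y)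
    (hx : x ∈ omegaUnion f) (hy : y ∈ omegaUnion f)
    (J : ℕ → Set G) (m : ℕ → ℕ)
    (hJ : ∀ n, IsPeriodicSubgraph f (J n) (m n))
    (hnest : ∀ n, J (n + 1) ⊆ J n)
    (hm : Filter.Tendsto m Filter.atTop Filter.atTop)
    (hmem : ∀ n, x ∈ J n ∧ y ∈ J n) :
    ∀ (k i : ℕ), i < m k →
      ∃ x' ∈ f^[i] '' J k, ∃ y' ∈ f^[i] '' J k,
        f^[m k - i] x' = x ∧ f^[m k - i] y' = y ∧
        IsNSPairOn (f^[m k]) (f^[i] '' J k) x' y' := by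
  intro k i hi
  have hd : m k - i ≤ m k := Nat.sub_le _ _
  have hmki : m k - (m k - i) = i := by omega
  obtain ⟨x', hx'x, hx'J, zx, hzx, hx'ω⟩ :=
    exists_preimage_mem_omegaSet hG hf hJ hm (fun n => (hmem n).1) hx hd
  obtain ⟨y', hy'y, hy'J, zy, hzy, hy'ω⟩ :=
    exists_preimage_mem_omegaSet hG hf hJ hm (fun n => (hmem n).2) hy hd
  have hx'k := hx'J k hd
  have hy'k := hy'J k hd
  rw [hmki] at hzx hzy hx'k hy'k
  have hanti : Antitone J := antitone_nat_of_succ_le hnest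
  have hdvd : ∀ {a b}, a ≤ b → m a ∣ m b := fun hab => (hJ _).dvd_of_subset (hJ _) (hanti hab)
  have hle : ∀ {a b}, a ≤ b → m a ≤ m b := fun hab => Nat.le_of_dvd (hJ _).2.1 (hdvd hab)
  have hsub : ∀ {a b}, a ≤ b → k ≤ a →
      f^[m b - (m k - i)] '' J b ⊆ f^[m a - (m k - i)] '' J a := by
    intro a b hab hka
    refine (image_mono (hanti hab)).trans ((hJ a).image_iterate_congr ?_).subset
    have hma := hle hka
    have hmb := hle hab
    apply Nat.ModEq.add_right_cancel' (m k - i)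
    rw [Nat.sub_add_cancel (by omega), Nat.sub_add_cancel (by omega)]
    exact ((Nat.modEq_zero_iff_dvd).2 (hdvd hab)).trans (by simp [Nat.ModEq])
  refine ⟨x', hx'k, y', hy'k, hx'x, hy'y, ?_, ⟨zx, hzx, hx'ω⟩, ⟨zy, hzy, hy'ω⟩,
    fun n => f^[m (n + k) - (m k - i)] '' J (n + k), fun n => m (n + k) / m k, ?_, ?_, ?_, ?_, ?_⟩
  · rintro rfl
    exact hxy (hx'x.symm.trans hy'y)
  · intro n
    exact (hJ _).image_iterate hG hf ⟨x, (hmem _).1, y, (hmem _).2, hxy⟩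
      (hdvd (Nat.le_add_left k n)) _
  · intro n
    have h := hsub (Nat.le_add_left k n) le_rfl
    rwa [hmki] at h
  · intro n
    exact hsub (by omega) (by omega)
  · exact (Nat.tendsto_div_const_atTop (hJ k).2.1.ne').comp
      (hm.comp (tendsto_add_atTop_nat k))
  · intro n
    have hn := hd.trans (hle (Nat.le_add_left k n))
    exact ⟨hx'J _ hn, hy'J _ hn⟩
end
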